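/- arXiv:1602.06217 — 5 statements merged into one kernel-verified Lean document; each statement's English description precedes it below -/
import Mathlib

section
/- Suppose ρ = 1 and α ∈ [0,1]. Set x_n := 1/4 − Var(Z_n). Then for every n ≥ 0, x_{n+1} ≥ (1 − r_n²/N) x_n; consequently x_n ≥ x_0 ∏_{k=0}^{n−1} (1 − r_k²/N), and if in addition Σ_n r_n² < +∞, then lim_{n→∞} x_n > 0 (note x_0 = E[Z_0(1 − Z_0)] > 0). -/
open MeasureTheory Filter Real

noncomputable section

/-- The σ-field `F_n = σ(Z_k(i) : 1 ≤ i ≤ N, 0 ≤ k ≤ n)` generated by the walks up to time `n`. -/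
def walkFiltration {Ω : Type*} [MeasurableSpace Ω] {N : ℕ}
    (Z : ℕ → Fin N → Ω → ℝ) (n : ℕ) : MeasurableSpace Ω :=
  ⨆ k ∈ Finset.range (n + 1), ⨆ i : Fin N, MeasurableSpace.comap (Z k i) (borel ℝ)

/-- The empirical mean `Z_n = N⁻¹ Σ_{i=1}^N Z_n(i)`. -/
def walkMean {Ω : Type*} {N : ℕ} (Z : ℕ → Fin N → Ω → ℝ) (n : ℕ) (ω : Ω) : ℝ :=
  (∑ i : Fin N, Z n i ω) / N

theorem walkFiltration_le' {Ω : Type*} [m0 : MeasurableSpace Ω] {N : ℕ}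
    (Z : ℕ → Fin N → Ω → ℝ) (hZ : ∀ n i, Measurable (Z n i)) (n : ℕ) :
    walkFiltration Z n ≤ m0 := by
  unfold walkFiltration
  refine iSup_le fun k => iSup_le fun _ => iSup_le fun i => ?_
  rw [← BorelSpace.measurable_eq (α := ℝ)]
  exact (hZ k i).comap_le

theorem walk_meas' {Ω : Type*} [m0 : MeasurableSpace Ω] {N : ℕ}
    (Z : ℕ → Fin N → Ω → ℝ) (n : ℕ) (i : Fin N) :
    Measurable[walkFiltration Z n] (Z n i) := by
  have h : MeasurableSpace.comap (Z n i) (borel ℝ) ≤ walkFiltration Z n := by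
    unfold walkFiltration
    refine le_iSup₂_of_le n (Finset.self_mem_range_succ n) ?_
    exact le_iSup (fun i => MeasurableSpace.comap (Z n i) (borel ℝ)) i
  rw [← BorelSpace.measurable_eq (α := ℝ)] at h
  exact (comap_measurable (Z n i)).mono h le_rfl

theorem walkMean_meas' {Ω : Type*} {m : MeasurableSpace Ω} {N : ℕ}
    (Z : ℕ → Fin N → Ω → ℝ) (n : ℕ) (h : ∀ i, Measurable[m] (Z n i)) :
    Measurable[m] (walkMean Z n) := by
  unfold walkMean
  exact (Finset.measurable_fun_sum _ fun i _ => h i).div_const _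

theorem walkMean_mem' {Ω : Type*} {N : ℕ} (hN : 1 ≤ N)
    (Z : ℕ → Fin N → Ω → ℝ) (n : ℕ) (ω : Ω) (h : ∀ i, Z n i ω ∈ Set.Icc (0:ℝ) 1) :
    walkMean Z n ω ∈ Set.Icc (0:ℝ) 1 := by
  have hN' : (0:ℝ) < N := by exact_mod_cast hN
  unfold walkMean
  constructor
  · exact div_nonneg (Finset.sum_nonneg fun i _ => (h i).1) hN'.le
  · rw [div_le_one hN']
    calc _ ≤ ∑ i : Fin N, (1:ℝ) := Finset.sum_le_sum fun i _ => (h i).2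
      _ = N := by simp

theorem int01 {Ω : Type*} [MeasurableSpace Ω] (μ : Measure Ω) [IsProbabilityMeasure μ]
    {f : Ω → ℝ} (hf : Measurable f) (h : ∀ ω, f ω ∈ Set.Icc (0:ℝ) 1) : Integrable f μ := by
  refine Integrable.of_bound hf.aestronglyMeasurable 1 (ae_of_all _ fun ω => ?_)
  rw [Real.norm_eq_abs, abs_of_nonneg (h ω).1]; exact (h ω).2

theorem mul01 {a b : ℝ} (ha : a ∈ Set.Icc (0:ℝ) 1) (hb : b ∈ Set.Icc (0:ℝ) 1) :
    a * b ∈ Set.Icc (0:ℝ) 1 := ⟨mul_nonneg ha.1 hb.1, mul_le_one₀ ha.2 hb.1 hb.2⟩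

theorem cond_int {Ω : Type*} {m m0 : MeasurableSpace Ω} (μ : Measure Ω) [IsProbabilityMeasure μ]
    (hm : m ≤ m0) {f g p : Ω → ℝ} (hf : Measurable[m] f) (hf1 : ∀ ω, f ω ∈ Set.Icc (0:ℝ) 1)
    (hg : Measurable g) (hg1 : ∀ ω, g ω ∈ Set.Icc (0:ℝ) 1) (hc : μ[g | m] =ᵐ[μ] p) :
    ∫ ω, f ω * g ω ∂μ = ∫ ω, f ω * p ω ∂μ := by
  have hgi := int01 μ hg hg1
  have hfg : Integrable (f * g) μ :=
    int01 μ ((hf.mono hm le_rfl).mul hg) fun ω => mul01 (hf1 ω) (hg1 ω)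
  have h1 := condExp_mul_of_stronglyMeasurable_left (μ := μ) hf.stronglyMeasurable hfg hgi
  have h2 := integral_condExp (μ := μ) (f := f * g) hm
  change ∫ ω, (f * g) ω ∂μ = _
  rw [← h2]
  refine integral_congr_ae ?_
  filter_upwards [h1, hc] with ω h1 h2
  rw [h1, Pi.mul_apply, h2]

theorem step_main {Ω : Type*} [MeasurableSpace Ω] (μ : Measure Ω) [IsProbabilityMeasure μ]
    (N : ℕ) (hN : 1 ≤ N) (α : ℝ) (hα : α ∈ Set.Icc (0:ℝ) 1)
    (r : ℕ → ℝ)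
    (Z : ℕ → Fin N → Ω → ℝ) (I : ℕ → Fin N → Ω → ℝ)
    (hZmeas : ∀ n i, Measurable (Z n i))
    (hImeas : ∀ n i, Measurable (I n i))
    (hZ01 : ∀ n i ω, Z n i ω ∈ Set.Icc (0:ℝ) 1)
    (hI01 : ∀ n i ω, I n i ω = 0 ∨ I n i ω = 1)
    (hdyn : ∀ n i ω, Z (n + 1) i ω = (1 - r n) * Z n i ω + r n * I n i ω)
    (hcond : ∀ n (s : Finset (Fin N)),
      μ[(fun ω => ∏ i ∈ s, I n i ω) | walkFiltration Z n]
        =ᵐ[μ] fun ω => ∏ i ∈ s, ((1 - α) * Z n i ω + α * walkMean Z n ω)) (n : ℕ) :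
    (∫ ω, walkMean Z (n+1) ω ∂μ = ∫ ω, walkMean Z n ω ∂μ) ∧
    ∃ D : ℝ, 0 ≤ D ∧ D ≤ (∫ ω, walkMean Z n ω * (1 - walkMean Z n ω) ∂μ) / N ∧
      ∫ ω, walkMean Z (n+1) ω ^ 2 ∂μ = ∫ ω, walkMean Z n ω ^ 2 ∂μ + r n ^ 2 * D := by
  have hN' : (0:ℝ) < N := by exact_mod_cast hN
  have hm := walkFiltration_le' Z hZmeas n
  have hI : ∀ i ω, I n i ω ∈ Set.Icc (0:ℝ) 1 := fun i ω => by
    rcases hI01 n i ω with h | h <;> simp [h]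
  set W := walkMean Z n with hW
  set J := walkMean I n with hJ
  have hW1 : ∀ ω, W ω ∈ Set.Icc (0:ℝ) 1 := fun ω => walkMean_mem' hN Z n ω fun i => hZ01 n i ω
  have hJ1 : ∀ ω, J ω ∈ Set.Icc (0:ℝ) 1 := fun ω => walkMean_mem' hN I n ω fun i => hI i ω
  have hWm : Measurable[walkFiltration Z n] W := walkMean_meas' Z n fun i => walk_meas' Z n i
  have hWm0 : Measurable W := hWm.mono hm le_rfl
  have hJm : Measurable J := walkMean_meas' I n fun i => hImeas n i
  let p : Fin N → Ω → ℝ := fun i ω => (1 - α) * Z n i ω + α * W ω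
  have hpm : ∀ i, Measurable (p i) := fun i =>
    ((hZmeas n i).const_mul _).add (hWm0.const_mul _)
  have hp1 : ∀ i ω, p i ω ∈ Set.Icc (0:ℝ) 1 := fun i ω =>
    (convex_Icc (0:ℝ) 1) (hZ01 n i ω) (hW1 ω) (by linarith [hα.2]) hα.1 (by ring)
  have hZsum : ∀ ω, ∑ i, Z n i ω = N * W ω := fun ω => by
    rw [hW]; unfold walkMean; field_simp
  have hpsum : ∀ ω, ∑ i, p i ω = N * W ω := fun ω => by
    simp only [p, Finset.sum_add_distrib, ← Finset.mul_sum, hZsum]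
    simp; ring
  have hc1 : ∀ i, μ[I n i | walkFiltration Z n] =ᵐ[μ] p i := fun i => by
    simpa using hcond n {i}
  -- first moments
  have hA : ∀ f : Ω → ℝ, Measurable[walkFiltration Z n] f → (∀ ω, f ω ∈ Set.Icc (0:ℝ) 1) →
      ∫ ω, f ω * J ω ∂μ = ∫ ω, f ω * W ω ∂μ := by
    intro f hf hf1
    have hf0 : Measurable f := hf.mono hm le_rfl
    have e1 : ∀ ω, f ω * J ω = (∑ i, f ω * I n i ω) / N := fun ω => by
      rw [hJ]; unfold walkMean; rw [← Finset.mul_sum]; ring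
    have e2 : ∀ ω, f ω * W ω = (∑ i, f ω * p i ω) / N := fun ω => by
      rw [← Finset.mul_sum, hpsum]; field_simp
    simp only [e1, e2, integral_div]
    rw [integral_finsetSum, integral_finsetSum]
    · congr 1
      exact Finset.sum_congr rfl fun i _ => cond_int μ hm hf hf1 (hImeas n i) (hI i) (hc1 i)
    · exact fun i _ => int01 μ (hf0.mul (hpm i)) fun ω => mul01 (hf1 ω) (hp1 i ω)
    · exact fun i _ => int01 μ (hf0.mul (hImeas n i)) fun ω => mul01 (hf1 ω) (hI i ω)
  have hdynW : ∀ ω, walkMean Z (n+1) ω = (1 - r n) * W ω + r n * J ω := fun ω => by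
    rw [hW, hJ]; unfold walkMean
    simp only [hdyn, Finset.sum_add_distrib, ← Finset.mul_sum]; ring
  have hEJ : ∫ ω, J ω ∂μ = ∫ ω, W ω ∂μ := by
    simpa using hA (fun _ => 1) measurable_const (by simp)
  have hWi := int01 μ hWm0 hW1
  have hJi := int01 μ hJm hJ1
  have hWW : Integrable (fun ω => W ω * W ω) μ := int01 μ (hWm0.mul hWm0) fun ω => mul01 (hW1 ω) (hW1 ω)
  have hWJ : Integrable (fun ω => W ω * J ω) μ := int01 μ (hWm0.mul hJm) fun ω => mul01 (hW1 ω) (hJ1 ω)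
  have hJJ : Integrable (fun ω => J ω * J ω) μ := int01 μ (hJm.mul hJm) fun ω => mul01 (hJ1 ω) (hJ1 ω)
  have hpp : ∀ i j, Integrable (fun ω => p i ω * p j ω) μ := fun i j =>
    int01 μ ((hpm i).mul (hpm j)) fun ω => mul01 (hp1 i ω) (hp1 j ω)
  have hpq : ∀ i, Integrable (fun ω => p i ω * (1 - p i ω)) μ := fun i =>
    int01 μ ((hpm i).mul ((hpm i).const_sub 1)) fun ω => mul01 (hp1 i ω)
      ⟨by linarith [(hp1 i ω).2], by linarith [(hp1 i ω).1]⟩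
  have hII : ∀ i j, ∫ ω, I n i ω * I n j ω ∂μ
      = ∫ ω, p i ω * p j ω ∂μ + if i = j then ∫ ω, p i ω * (1 - p i ω) ∂μ else 0 := by
    intro i j
    split_ifs with hij
    · subst hij
      rw [← integral_add (hpp i i) (hpq i)]
      have e1 : ∀ ω, I n i ω * I n i ω = 1 * I n i ω := fun ω => by
        rcases hI01 n i ω with h | h <;> simp [h]
      have e2 : ∀ ω, p i ω * p i ω + p i ω * (1 - p i ω) = 1 * p i ω := fun ω => by ring
      simp only [e1, e2]
      exact cond_int μ hm (f := fun _ => 1) measurable_const (by simp) (hImeas n i) (hI i) (hc1 i)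
    · have := hcond n {i, j}
      simp only [Finset.prod_pair hij] at this
      have h := cond_int μ hm (f := fun _ => 1) measurable_const (by simp)
        ((hImeas n i).mul (hImeas n j)) (fun ω => mul01 (hI i ω) (hI j ω)) this
      simpa using h
  have hEJJ : ∫ ω, J ω * J ω ∂μ = ∫ ω, W ω * W ω ∂μ
      + (∑ i, ∫ ω, p i ω * (1 - p i ω) ∂μ) / N ^ 2 := by
    have e1 : ∀ ω, J ω * J ω = (∑ i, ∑ j, I n i ω * I n j ω) / N ^ 2 := fun ω => by
      rw [hJ]; unfold walkMean; rw [← Finset.sum_mul_sum]; ring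
    have e2 : ∀ ω, W ω * W ω = (∑ i, ∑ j, p i ω * p j ω) / N ^ 2 := fun ω => by
      rw [← Finset.sum_mul_sum, hpsum]; field_simp
    have hIIi : ∀ i j, Integrable (fun ω => I n i ω * I n j ω) μ := fun i j =>
      int01 μ ((hImeas n i).mul (hImeas n j)) fun ω => mul01 (hI i ω) (hI j ω)
    simp only [e1, e2, integral_div]
    rw [integral_finsetSum _ fun i _ => integrable_finsetSum _ fun j _ => hIIi i j,
      integral_finsetSum _ fun i _ => integrable_finsetSum _ fun j _ => hpp i j, ← add_div]
    congr 1
    rw [← Finset.sum_add_distrib]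
    refine Finset.sum_congr rfl fun i _ => ?_
    rw [integral_finsetSum _ fun j _ => hIIi i j, integral_finsetSum _ fun j _ => hpp i j]
    simp only [hII, Finset.sum_add_distrib]
    simp
  refine ⟨?_, (∑ i, ∫ ω, p i ω * (1 - p i ω) ∂μ) / N ^ 2, ?_, ?_, ?_⟩
  · simp only [hdynW]
    rw [integral_add (hWi.const_mul _) (hJi.const_mul _), integral_const_mul, integral_const_mul,
      hEJ]
    ring
  · refine div_nonneg (Finset.sum_nonneg fun i _ => integral_nonneg fun ω => ?_) (by positivity)
    exact mul_nonneg (hp1 i ω).1 (by linarith [(hp1 i ω).2])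
  · have key : ∑ i, ∫ ω, p i ω * (1 - p i ω) ∂μ ≤ N * ∫ ω, W ω * (1 - W ω) ∂μ := by
      rw [← integral_finsetSum _ fun i _ => hpq i, ← integral_const_mul]
      refine integral_mono (integrable_finsetSum _ fun i _ => hpq i) ?_ fun ω => ?_
      · refine (int01 μ (hWm0.mul (hWm0.const_sub 1)) fun ω => mul01 (hW1 ω)
          ⟨by linarith [(hW1 ω).2], by linarith [(hW1 ω).1]⟩).const_mul _
      · have h1 : (∑ i, p i ω) ^ 2 ≤ (N:ℝ) * ∑ i, p i ω ^ 2 := by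
          simpa using sq_sum_le_card_mul_sum_sq (s := Finset.univ) (f := fun i => p i ω)
        have h2 : ∑ i, p i ω * (1 - p i ω) = ∑ i, p i ω - ∑ i, p i ω ^ 2 := by
          rw [← Finset.sum_sub_distrib]; exact Finset.sum_congr rfl fun i _ => by ring
        rw [hpsum] at h1 h2
        have h3 : (N:ℝ) * W ω ^ 2 ≤ ∑ i, p i ω ^ 2 := by
          refine le_of_mul_le_mul_left ?_ hN'
          linarith
        change ∑ i, p i ω * (1 - p i ω) ≤ N * (W ω * (1 - W ω))
        rw [h2]; linarith
    rw [div_le_div_iff₀ (by positivity) hN']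
    nlinarith
  · have e : ∀ ω, walkMean Z (n+1) ω ^ 2 = (1 - r n) ^ 2 * (W ω * W ω)
        + 2 * r n * (1 - r n) * (W ω * J ω) + r n ^ 2 * (J ω * J ω) := fun ω => by
      rw [hdynW]; ring
    simp only [e]
    have h12 : Integrable (fun ω => (1 - r n) ^ 2 * (W ω * W ω)
        + 2 * r n * (1 - r n) * (W ω * J ω)) μ := (hWW.const_mul _).add (hWJ.const_mul _)
    rw [integral_add h12 (hJJ.const_mul _),
      integral_add (hWW.const_mul _) (hWJ.const_mul _), integral_const_mul, integral_const_mul,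
      integral_const_mul, hEJJ, hA W hWm hW1]
    simp only [pow_two (W _)]
    ring

/-- **Variance recursion (upper bound)**: for `ρ = 1`, setting `x_n := 1/4 - Var(Z_n)`,
one has `x_{n+1} ≥ (1 - r_n²/N) x_n`, hence `x_n ≥ x_0 ∏_{k<n} (1 - r_k²/N)`; if moreover
`Σ r_n² < +∞`, then `lim x_n > 0`. -/
theorem stmt_14
    {Ω : Type*} [MeasurableSpace Ω] (μ : Measure Ω) [IsProbabilityMeasure μ]
    (N : ℕ) (hN : 1 ≤ N)
    (ρ α q : ℝ)
    (hρ : ρ ∈ Set.Icc (0:ℝ) 1) (hα : α ∈ Set.Icc (0:ℝ) 1) (hq : q ∈ Set.Icc (0:ℝ) 1)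
    (r : ℕ → ℝ) (hr : ∀ n, 0 ≤ r n ∧ r n < 1)
    (Z : ℕ → Fin N → Ω → ℝ) (I : ℕ → Fin N → Ω → ℝ)
    (hZmeas : ∀ n i, Measurable (Z n i))
    (hImeas : ∀ n i, Measurable (I n i))
    (hZ01 : ∀ n i ω, Z n i ω ∈ Set.Icc (0:ℝ) 1)
    (hI01 : ∀ n i ω, I n i ω = 0 ∨ I n i ω = 1)
    -- dynamics: `Z_{n+1}(i) = (1 - r_n) Z_n(i) + r_n (ρ I_{n+1}(i) + (1-ρ) q)`
    -- (here `I n i` stands for `I_{n+1}(i)`)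
    (hdyn : ∀ n i ω, Z (n + 1) i ω
      = (1 - r n) * Z n i ω + r n * (ρ * I n i ω + (1 - ρ) * q))
    -- conditional independence of `I_{n+1}(1), …, I_{n+1}(N)` given `F_n`, together with
    -- the conditional law `P(I_{n+1}(i) = 1 | F_n) = (1-α) Z_n(i) + α Z_n`, expressed
    -- (equivalently, for {0,1}-valued variables) through conditional product moments
    (hcond : ∀ n (s : Finset (Fin N)),
      μ[(fun ω => ∏ i ∈ s, I n i ω) | walkFiltration Z n]
        =ᵐ[μ] fun ω => ∏ i ∈ s, ((1 - α) * Z n i ω + α * walkMean Z n ω))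
    -- the initial configuration is permutation invariant with mean 1/2 and E[Z_0(1-Z_0)] > 0
    (hperm : ∀ σ : Equiv.Perm (Fin N),
      μ.map (fun ω (i : Fin N) => Z 0 (σ i) ω) = μ.map (fun ω (i : Fin N) => Z 0 i ω))
    (hmean0 : ∀ i, ∫ ω, Z 0 i ω ∂μ = 1 / 2)
    (hvar0 : 0 < ∫ ω, walkMean Z 0 ω * (1 - walkMean Z 0 ω) ∂μ)
    (hρ1 : ρ = 1)
    (x : ℕ → ℝ)
    (hx : ∀ n, x n = 1 / 4 - ProbabilityTheory.variance (fun ω => walkMean Z n ω) μ) :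
    (∀ n, (1 - (r n) ^ 2 / N) * x n ≤ x (n + 1))
    ∧ (∀ n, x 0 * ∏ k ∈ Finset.range n, (1 - (r k) ^ 2 / N) ≤ x n)
    ∧ (Summable (fun n => (r n) ^ 2) →
        ∃ L : ℝ, 0 < L ∧ Tendsto x atTop (nhds L)) := by
  subst hρ1
  have hN' : (1:ℝ) ≤ N := by exact_mod_cast hN
  have hstep := step_main μ N hN α hα r Z I hZmeas hImeas hZ01 hI01
    (fun n i ω => by rw [hdyn]; ring) hcond
  have hWm : ∀ n, Measurable (walkMean Z n) := fun n => walkMean_meas' Z n (hZmeas n)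
  have hW1 : ∀ n ω, walkMean Z n ω ∈ Set.Icc (0:ℝ) 1 := fun n ω =>
    walkMean_mem' hN Z n ω fun i => hZ01 n i ω
  have hmean : ∀ n, ∫ ω, walkMean Z n ω ∂μ = 1 / 2 := by
    intro n
    induction n with
    | zero =>
      unfold walkMean
      rw [integral_div, integral_finsetSum _ fun i _ => int01 μ (hZmeas 0 i) (hZ01 0 i)]
      simp only [hmean0]
      simp
      field_simp
    | succ k ih => rw [(hstep k).1, ih]
  have hsq : ∀ n, Integrable (fun ω => walkMean Z n ω ^ 2) μ := fun n => by
    simp only [pow_two]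
    exact int01 μ ((hWm n).mul (hWm n)) fun ω => mul01 (hW1 n ω) (hW1 n ω)
  have hx1 : ∀ n, x n = 1 / 2 - ∫ ω, walkMean Z n ω ^ 2 ∂μ := fun n => by
    have hL : MemLp (walkMean Z n) 2 μ := MemLp.of_bound (hWm n).aestronglyMeasurable 1
      (ae_of_all _ fun ω => by
        rw [Real.norm_eq_abs, abs_of_nonneg (hW1 n ω).1]; exact (hW1 n ω).2)
    have := ProbabilityTheory.variance_eq_sub hL
    rw [hx]
    change 1 / 4 - ProbabilityTheory.variance (walkMean Z n) μ = _
    rw [this, hmean]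
    simp only [Pi.pow_apply]
    ring
  have hx2 : ∀ n, x n = ∫ ω, walkMean Z n ω * (1 - walkMean Z n ω) ∂μ := fun n => by
    have e : ∀ ω, walkMean Z n ω * (1 - walkMean Z n ω) = walkMean Z n ω - walkMean Z n ω ^ 2 :=
      fun ω => by ring
    simp only [e]
    rw [integral_sub (int01 μ (hWm n) (hW1 n)) (hsq n), hx1, hmean]
  have hx0 : 0 < x 0 := by rw [hx2]; exact hvar0
  have ha0 : ∀ n, 0 ≤ r n ^ 2 / N := fun n => by positivity
  have ha1 : ∀ n, 0 < 1 - r n ^ 2 / N := fun n => by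
    have h1 : r n ^ 2 < 1 := by nlinarith [(hr n).1, (hr n).2]
    have h2 : r n ^ 2 / N ≤ r n ^ 2 := div_le_self (sq_nonneg _) hN'
    linarith
  have h1 : ∀ n, (1 - (r n) ^ 2 / N) * x n ≤ x (n + 1) := fun n => by
    obtain ⟨-, D, hD0, hD1, hD⟩ := hstep n
    rw [← hx2] at hD1
    have h := mul_le_mul_of_nonneg_left hD1 (sq_nonneg (r n))
    have e : (1 - (r n) ^ 2 / N) * x n = x n - r n ^ 2 * (x n / N) := by ring
    rw [e]
    have := hx1 n
    have := hx1 (n+1)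
    linarith
  have hanti : ∀ n, x (n + 1) ≤ x n := fun n => by
    obtain ⟨-, D, hD0, hD1, hD⟩ := hstep n
    have := hx1 n
    have := hx1 (n+1)
    have := mul_nonneg (sq_nonneg (r n)) hD0
    linarith
  have h2 : ∀ n, x 0 * ∏ k ∈ Finset.range n, (1 - (r k) ^ 2 / N) ≤ x n := by
    intro n
    induction n with
    | zero => simp
    | succ k ih =>
      rw [Finset.prod_range_succ]
      have := mul_le_mul_of_nonneg_left ih (ha1 k).le
      linarith [h1 k]
  refine ⟨h1, h2, fun hs => ?_⟩
  have hpos : ∀ n, 0 < x n := fun n =>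
    lt_of_lt_of_le (mul_pos hx0 (Finset.prod_pos fun k _ => ha1 k)) (h2 n)
  have hA : Antitone x := antitone_nat_of_succ_le hanti
  have hs' : Summable (fun n => r n ^ 2 / (N:ℝ)) := hs.div_const _
  have ht := tendsto_sum_nat_add (fun n => r n ^ 2 / (N:ℝ))
  obtain ⟨m, hm⟩ := (ht.eventually (gt_mem_nhds (show (0:ℝ) < 1 / 2 by norm_num))).exists
  have hlow : ∀ n, x m * (1 - ∑ k ∈ Finset.range n, r (k + m) ^ 2 / (N:ℝ)) ≤ x (n + m) := by
    intro n
    induction n with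
    | zero => simp
    | succ k ih =>
      rw [Finset.sum_range_succ]
      have e1 := h1 (k + m)
      have e2 := mul_le_mul_of_nonneg_left (hA (Nat.le_add_left m k)) (ha0 (k + m))
      rw [show k + 1 + m = k + m + 1 by ring]
      linarith
  have hhalf : ∀ n, x m / 2 ≤ x n := by
    intro n
    refine le_trans ?_ (hA (Nat.le_add_right n m))
    refine le_trans ?_ (hlow n)
    have := ((summable_nat_add_iff m).2 hs').sum_le_tsum (Finset.range n) (fun k _ => ha0 (k + m))
    have h3 := mul_le_mul_of_nonneg_left (this.trans hm.le) (hpos m).le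
    linarith
  have hbdd : BddBelow (Set.range x) := ⟨x m / 2, by rintro _ ⟨n, rfl⟩; exact hhalf n⟩
  have hlim := tendsto_atTop_ciInf hA hbdd
  refine ⟨_, lt_of_lt_of_le (half_pos (hpos m)) (ge_of_tendsto' hlim hhalf), hlim⟩
end
end

section
/- Suppose ρ(1 − α) < 1, Σ_n r_n = +∞ and Σ_n r_n² < +∞. Then there is a random variable Z such that Z_n(i) → Z almost surely for every i, and moreover: (a) for every i, the conditional variance Var[I_{n+1}(i) | F_n] = ((1−α)Z_n(i) + αZ_n)(1 − (1−α)Z_n(i) − αZ_n) converges almost surely to Z(1 − Z); (b) E[(N^{-1} Σ_{i=1}^N I_{n+1}(i) − Z_n)² | F_n] converges almost surely to Z(1 − Z)/N. -/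
open MeasureTheory Filter Real

noncomputable section

lemma aux_det1 (a t y : ℕ → ℝ) (ha : ∀ n, 0 ≤ a n ∧ a n ≤ 1) (hs : ¬ Summable a)
    (ht : Tendsto t atTop (nhds 0)) (hy : ∀ n, 0 ≤ y n)
    (h : ∀ n, y (n + 1) ≤ (1 - a n) * y n + a n * t n) : Tendsto y atTop (nhds 0) := by
  rw [Metric.tendsto_atTop]
  intro ε hε
  obtain ⟨K, hK⟩ := Metric.tendsto_atTop.1 ht (ε / 2) (by positivity)
  have hdiv : Tendsto (fun m => ∑ j ∈ Finset.range m, a (j + K)) atTop atTop := by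
    apply (not_summable_iff_tendsto_nat_atTop_of_nonneg (fun n => (ha _).1)).1
    rwa [summable_nat_add_iff]
  have key : ∀ m, y (m + K) - ε / 2
      ≤ Real.exp (-(∑ j ∈ Finset.range m, a (j + K))) * |y K - ε / 2| := by
    intro m
    induction m with
    | zero => simpa using le_abs_self (y K - ε / 2)
    | succ m ih =>
      have h1 := h (m + K)
      have h2 := hK (m + K) (by omega)
      rw [Real.dist_eq, sub_zero] at h2
      have h3 := (le_abs_self _).trans h2.le
      obtain ⟨h4, h5⟩ := ha (m + K)
      have h6 : a (m + K) * t (m + K) ≤ a (m + K) * (ε / 2) :=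
        mul_le_mul_of_nonneg_left h3 h4
      have h7 := mul_le_mul_of_nonneg_left ih (sub_nonneg.2 h5)
      have h8 : 1 - a (m + K) ≤ Real.exp (-a (m + K)) := Real.one_sub_le_exp_neg _
      have h9 := mul_le_mul_of_nonneg_right h8 (mul_nonneg
        (Real.exp_nonneg (-(∑ j ∈ Finset.range m, a (j + K)))) (abs_nonneg (y K - ε / 2)))
      rw [Finset.sum_range_succ, neg_add_rev, Real.exp_add,
        show m + 1 + K = m + K + 1 by ring]
      linarith
  have hlim : Tendsto (fun m => Real.exp (-(∑ j ∈ Finset.range m, a (j + K))) * |y K - ε / 2|)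
      atTop (nhds 0) := by
    have := (Real.tendsto_exp_neg_atTop_nhds_zero.comp hdiv).mul_const |y K - ε / 2|
    simpa using this
  obtain ⟨m0, hm0⟩ := eventually_atTop.1 (hlim.eventually (gt_mem_nhds (half_pos hε)))
  refine ⟨m0 + K, fun n hn => ?_⟩
  have h1 := hm0 (n - K) (by omega)
  have h2 := key (n - K)
  rw [show n - K + K = n by omega] at h2
  rw [Real.dist_eq, sub_zero, abs_of_nonneg (hy n)]
  linarith

lemma aux_det2 (r X M : ℕ → ℝ) (c L : ℝ) (hc : 0 < c) (hr : ∀ n, 0 ≤ r n ∧ c * r n ≤ 1)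
    (hs : ¬ Summable r) (hM : Tendsto M atTop (nhds L))
    (h : ∀ n, X (n + 1) = (1 - c * r n) * X n + (M (n + 1) - M n)) :
    Tendsto X atTop (nhds 0) := by
  have hT : Tendsto (fun n => L - M n) atTop (nhds 0) := by
    simpa using hM.const_sub L
  have hY : Tendsto (fun n => |X n + (L - M n)|) atTop (nhds 0) := by
    refine aux_det1 (fun n => c * r n) (fun n => |L - M n|) _
      (fun n => ⟨mul_nonneg hc.le (hr n).1, (hr n).2⟩) ?_ ?_ (fun n => abs_nonneg _) ?_
    · rwa [summable_mul_left_iff hc.ne']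
    · simpa using hT.abs
    · intro n
      have h0 := mul_nonneg hc.le (hr n).1
      have h1 := sub_nonneg.2 (hr n).2
      have : X (n + 1) + (L - M (n + 1))
        = (1 - c * r n) * (X n + (L - M n)) + c * r n * (L - M n) := by rw [h]; ring
      rw [this]
      refine (abs_add_le _ _).trans ?_
      rw [abs_mul, abs_mul, abs_of_nonneg h0, abs_of_nonneg h1]
  have := ((tendsto_zero_iff_abs_tendsto_zero _).2 hY).sub hT
  simpa using this

lemma aux_mart {Ω : Type*} {m0 : MeasurableSpace Ω} (μ : Measure Ω) [IsProbabilityMeasure μ]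
    (F : Filtration ℕ m0) (r : ℕ → ℝ) (D : ℕ → Ω → ℝ)
    (hD : ∀ n, StronglyMeasurable[F (n + 1)] (D n)) (hb : ∀ n ω, |D n ω| ≤ r n)
    (hc : ∀ n, μ[D n | F n] =ᵐ[μ] 0) (hrsq : Summable (fun n => (r n) ^ 2)) :
    ∀ᵐ ω ∂μ, ∃ L, Tendsto (fun n => ∑ k ∈ Finset.range n, D k ω) atTop (nhds L) := by
  set M : ℕ → Ω → ℝ := fun n ω => ∑ k ∈ Finset.range n, D k ω with hMdef
  have hMsucc : ∀ n ω, M (n + 1) ω = M n ω + D n ω := fun n ω => by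
    simp [hMdef, Finset.sum_range_succ]
  have hDm : ∀ n, AEStronglyMeasurable (D n) μ := fun n =>
    ((hD n).mono (F.le _)).aestronglyMeasurable
  have hDi : ∀ n, Integrable (D n) μ := fun n =>
    Integrable.of_bound (hDm n) (r n) (ae_of_all _ fun ω => by simpa using hb n ω)
  have hMad : ∀ n, StronglyMeasurable[F n] (M n) := fun n =>
    Finset.stronglyMeasurable_fun_sum _ fun k hk =>
      (hD k).mono (F.mono (by simpa using hk))
  have hMb : ∀ n ω, |M n ω| ≤ ∑ k ∈ Finset.range n, r k := fun n ω =>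
    (Finset.abs_sum_le_sum_abs _ _).trans (Finset.sum_le_sum fun k _ => hb k ω)
  have hMm : ∀ n, AEStronglyMeasurable (M n) μ := fun n =>
    ((hMad n).mono (F.le _)).aestronglyMeasurable
  have hMi : ∀ n, Integrable (M n) μ := fun n =>
    Integrable.of_bound (hMm n) _ (ae_of_all _ fun ω => by simpa using hMb n ω)
  have hMart : Martingale M F μ := by
    refine martingale_of_condExp_sub_eq_zero_nat hMad hMi fun n => ?_
    have : M (n + 1) - M n = D n := by ext ω; simp [hMsucc]
    rw [this]; exact hc n
  have hM2i : ∀ n, Integrable (fun ω => M n ω ^ 2) μ := fun n =>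
    Integrable.of_bound ((hMm n).pow 2) ((∑ k ∈ Finset.range n, r k) ^ 2)
      (ae_of_all _ fun ω => by
        rw [Real.norm_eq_abs, abs_pow]
        exact pow_le_pow_left₀ (abs_nonneg _) (hMb n ω) 2)
  have hD2i : ∀ n, Integrable (fun ω => D n ω ^ 2) μ := fun n =>
    Integrable.of_bound ((hDm n).pow 2) (r n ^ 2)
      (ae_of_all _ fun ω => by
        rw [Real.norm_eq_abs, abs_pow]
        exact pow_le_pow_left₀ (abs_nonneg _) (hb n ω) 2)
  have hMDi : ∀ n, Integrable (M n * D n) μ := fun n =>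
    (hDi n).bdd_mul (hMm n) (ae_of_all _ fun ω => by simpa using hMb n ω)
  have hcross : ∀ n, ∫ ω, (M n * D n) ω ∂μ = 0 := fun n => by
    rw [← integral_condExp (F.le n)]
    have h1 := condExp_mul_of_stronglyMeasurable_left (hMad n) (hMDi n) (hDi n)
    have h2 : μ[M n * D n | F n] =ᵐ[μ] 0 := by
      filter_upwards [h1, hc n] with ω h1 h2
      simp [h1, h2]
    rw [integral_congr_ae h2]; simp
  have hE : ∀ n, ∫ ω, M n ω ^ 2 ∂μ ≤ ∑ k ∈ Finset.range n, r k ^ 2 := by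
    intro n
    induction n with
    | zero => simp [hMdef]
    | succ n ih =>
      have e : ∀ ω, M (n + 1) ω ^ 2 = M n ω ^ 2 + 2 * (M n * D n) ω + D n ω ^ 2 := fun ω => by
        rw [hMsucc]; simp; ring
      simp_rw [e]
      have hsi : Integrable (fun ω => M n ω ^ 2 + 2 * (M n * D n) ω) μ :=
        (hM2i n).add ((hMDi n).const_mul 2)
      rw [integral_add hsi (hD2i n),
        integral_add (hM2i n) ((hMDi n).const_mul 2), integral_const_mul, hcross,
        Finset.sum_range_succ]
      have : ∫ ω, D n ω ^ 2 ∂μ ≤ ∫ ω, r n ^ 2 ∂μ := by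
        refine integral_mono (hD2i n) (integrable_const _) fun ω => ?_
        have := pow_le_pow_left₀ (abs_nonneg _) (hb n ω) 2
        rwa [sq_abs] at this
      simp at this
      linarith
  have hL1 : ∀ n, eLpNorm (M n) 1 μ ≤ ((1 + ∑' k, r k ^ 2).toNNReal : NNReal) := by
    intro n
    rw [eLpNorm_one_eq_lintegral_enorm, ← ofReal_integral_norm_eq_lintegral_enorm (hMi n)]
    apply ENNReal.ofReal_le_ofReal
    have : ∫ ω, ‖M n ω‖ ∂μ ≤ ∫ ω, (1 + M n ω ^ 2) ∂μ := by
      refine integral_mono (hMi n).norm ((integrable_const _).add (hM2i n)) fun ω => ?_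
      simp only [Real.norm_eq_abs]
      nlinarith [sq_abs (M n ω), sq_nonneg (|M n ω| - 1), abs_nonneg (M n ω)]
    rw [integral_add (integrable_const _) (hM2i n)] at this
    simp only [integral_const, probReal_univ, smul_eq_mul, mul_one] at this
    have h2 := hrsq.sum_le_tsum (Finset.range n) (fun k _ => sq_nonneg (r k))
    linarith [hE n]
  filter_upwards [hMart.submartingale.ae_tendsto_limitProcess hL1] with ω h
  exact ⟨_, h⟩

/-- **Limits of conditional variances**: if `ρ(1-α) < 1`, `Σ r_n = +∞` and
`Σ r_n² < +∞`, there is `Z` with `Z_n(i) → Z` a.s. for all `i`, and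
(a) `Var[I_{n+1}(i) | F_n] = ((1-α)Z_n(i) + αZ_n)(1 - (1-α)Z_n(i) - αZ_n) → Z(1-Z)` a.s.;
(b) `E[(N⁻¹ Σ_i I_{n+1}(i) - Z_n)² | F_n] → Z(1-Z)/N` a.s. -/
theorem stmt_15
    {Ω : Type*} [MeasurableSpace Ω] (μ : Measure Ω) [IsProbabilityMeasure μ]
    (N : ℕ) (hN : 1 ≤ N)
    (ρ α q : ℝ)
    (hρ : ρ ∈ Set.Icc (0:ℝ) 1) (hα : α ∈ Set.Icc (0:ℝ) 1) (hq : q ∈ Set.Icc (0:ℝ) 1)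
    (r : ℕ → ℝ) (hr : ∀ n, 0 ≤ r n ∧ r n < 1)
    (Z : ℕ → Fin N → Ω → ℝ) (I : ℕ → Fin N → Ω → ℝ)
    (hZmeas : ∀ n i, Measurable (Z n i))
    (hImeas : ∀ n i, Measurable (I n i))
    (hZ01 : ∀ n i ω, Z n i ω ∈ Set.Icc (0:ℝ) 1)
    (hI01 : ∀ n i ω, I n i ω = 0 ∨ I n i ω = 1)
    -- dynamics: `Z_{n+1}(i) = (1 - r_n) Z_n(i) + r_n (ρ I_{n+1}(i) + (1-ρ) q)`
    -- (here `I n i` stands for `I_{n+1}(i)`)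
    (hdyn : ∀ n i ω, Z (n + 1) i ω
      = (1 - r n) * Z n i ω + r n * (ρ * I n i ω + (1 - ρ) * q))
    -- conditional independence of `I_{n+1}(1), …, I_{n+1}(N)` given `F_n`, together with
    -- the conditional law `P(I_{n+1}(i) = 1 | F_n) = (1-α) Z_n(i) + α Z_n`, expressed
    -- (equivalently, for {0,1}-valued variables) through conditional product moments
    (hcond : ∀ n (s : Finset (Fin N)),
      μ[(fun ω => ∏ i ∈ s, I n i ω) | walkFiltration Z n]
        =ᵐ[μ] fun ω => ∏ i ∈ s, ((1 - α) * Z n i ω + α * walkMean Z n ω))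
    -- the initial configuration is permutation invariant with mean 1/2 and E[Z_0(1-Z_0)] > 0
    (hperm : ∀ σ : Equiv.Perm (Fin N),
      μ.map (fun ω (i : Fin N) => Z 0 (σ i) ω) = μ.map (fun ω (i : Fin N) => Z 0 i ω))
    (hmean0 : ∀ i, ∫ ω, Z 0 i ω ∂μ = 1 / 2)
    (hvar0 : 0 < ∫ ω, walkMean Z 0 ω * (1 - walkMean Z 0 ω) ∂μ)
    (hρα : ρ * (1 - α) < 1) (hrdiv : ¬ Summable r) (hrsq : Summable (fun n => (r n) ^ 2)) :
    ∃ Zlim : Ω → ℝ,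
      (∀ i : Fin N, ∀ᵐ ω ∂μ, Tendsto (fun n => Z n i ω) atTop (nhds (Zlim ω)))
      ∧ (∀ i : Fin N, ∀ᵐ ω ∂μ, Tendsto
          (fun n => ((1 - α) * Z n i ω + α * walkMean Z n ω)
              * (1 - ((1 - α) * Z n i ω + α * walkMean Z n ω)))
          atTop (nhds (Zlim ω * (1 - Zlim ω))))
      ∧ (∀ᵐ ω ∂μ, Tendsto
          (fun n => (μ[(fun ω' => ((∑ i : Fin N, I n i ω') / N - walkMean Z n ω') ^ 2)
              | walkFiltration Z n]) ω)
          atTop (nhds (Zlim ω * (1 - Zlim ω) / N))) := by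
  classical
  have hN0 : (N : ℝ) ≠ 0 := by positivity
  have hNpos : (0 : ℝ) < N := by positivity
  have hle : ∀ n, walkFiltration Z n ≤ (inferInstance : MeasurableSpace Ω) := by
    intro n
    refine iSup₂_le fun k _ => iSup_le fun i => (hZmeas k i).comap_le
  let F : Filtration ℕ (inferInstance : MeasurableSpace Ω) :=
    { seq := walkFiltration Z
      mono' := by
        intro a b hab
        refine iSup₂_le fun k hk => ?_
        refine le_iSup₂_of_le (f := fun k (_ : k ∈ Finset.range (b + 1)) =>
          ⨆ i : Fin N, MeasurableSpace.comap (Z k i) (borel ℝ)) k ?_ le_rfl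
        simp at hk ⊢; omega
      le' := hle }
  have hZF : ∀ n i, Measurable[F n] (Z n i) := by
    intro n i
    refine measurable_iff_comap_le.2 ?_
    refine le_trans ?_ (le_iSup₂_of_le (f := fun k (_ : k ∈ Finset.range (n + 1)) =>
          ⨆ i : Fin N, MeasurableSpace.comap (Z k i) (borel ℝ)) n (by simp) le_rfl)
    exact le_iSup (fun i : Fin N => MeasurableSpace.comap (Z n i) (borel ℝ)) i
  have hWF : ∀ n, Measurable[F n] (walkMean Z n) := by
    intro n
    exact (Finset.measurable_fun_sum _ fun i _ => hZF n i).div_const _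
  set P : ℕ → Fin N → Ω → ℝ := fun n i ω => (1 - α) * Z n i ω + α * walkMean Z n ω with hP
  have hPF : ∀ n i, Measurable[F n] (P n i) := fun n i =>
    ((hZF n i).const_mul _).add ((hWF n).const_mul _)
  have hW01 : ∀ n ω, 0 ≤ walkMean Z n ω ∧ walkMean Z n ω ≤ 1 := by
    intro n ω
    constructor
    · exact div_nonneg (Finset.sum_nonneg fun i _ => (hZ01 n i ω).1) hNpos.le
    · rw [walkMean, div_le_one hNpos]
      refine (Finset.sum_le_sum fun i _ => (hZ01 n i ω).2).trans ?_
      simp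
  have hP01 : ∀ n i ω, 0 ≤ P n i ω ∧ P n i ω ≤ 1 := by
    intro n i ω
    obtain ⟨a1, a2⟩ := hα
    obtain ⟨b1, b2⟩ := hZ01 n i ω
    obtain ⟨c1, c2⟩ := hW01 n ω
    simp only [hP]
    constructor <;> nlinarith
  have hI01' : ∀ n i ω, 0 ≤ I n i ω ∧ I n i ω ≤ 1 := by
    intro n i ω
    rcases hI01 n i ω with h | h <;> rw [h] <;> norm_num
  have hIprod : ∀ n (s : Finset (Fin N)), Integrable (fun ω => ∏ i ∈ s, I n i ω) μ := by
    intro n s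
    refine Integrable.of_bound
      (Finset.measurable_fun_prod _ fun i _ => hImeas n i).aestronglyMeasurable 1
      (ae_of_all _ fun ω => ?_)
    rw [Real.norm_eq_abs, abs_of_nonneg (Finset.prod_nonneg fun i _ => (hI01' n i ω).1)]
    exact Finset.prod_le_one (fun i _ => (hI01' n i ω).1) (fun i _ => (hI01' n i ω).2)
  have hIi : ∀ n i, Integrable (I n i) μ := fun n i => by simpa using hIprod n {i}
  have hPm : ∀ n i, Measurable (P n i) := fun n i => (hPF n i).mono (hle n) le_rfl
  have hPi : ∀ n i, Integrable (P n i) μ := fun n i =>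
    Integrable.of_bound (hPm n i).aestronglyMeasurable 1 (ae_of_all _ fun ω => by
      rw [Real.norm_eq_abs, abs_of_nonneg (hP01 n i ω).1]; exact (hP01 n i ω).2)
  have hcI : ∀ n i, μ[I n i | F n] =ᵐ[μ] P n i := fun n i => by
    simpa using hcond n {i}
  let D : Fin N → ℕ → Ω → ℝ := fun i n ω => (r n * ρ) * (I n i ω - P n i ω)
  have hconv : ∀ᵐ ω ∂μ, ∀ i, ∃ L,
      Tendsto (fun n => ∑ k ∈ Finset.range n, D i k ω) atTop (nhds L) := by
    rw [ae_all_iff]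
    intro i
    refine aux_mart μ F r (D i) ?_ ?_ ?_ hrsq
    · intro n
      have e : D i n = fun ω => Z (n + 1) i ω - ((1 - r n) * Z n i ω + r n * ((1 - ρ) * q))
          - (r n * ρ) * P n i ω := by
        ext ω; simp only [D, hdyn]; ring
      rw [e]
      have hz : Measurable[F (n + 1)] (Z n i) := (hZF n i).mono (F.mono n.le_succ) le_rfl
      have hp : Measurable[F (n + 1)] (P n i) := (hPF n i).mono (F.mono n.le_succ) le_rfl
      exact (((hZF (n + 1) i).sub ((hz.const_mul _).add_const _)).sub
        (hp.const_mul _)).stronglyMeasurable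
    · intro n ω
      have h1 : |I n i ω - P n i ω| ≤ 1 := by
        rw [abs_le]
        constructor <;> linarith [hI01' n i ω, hP01 n i ω, (hI01' n i ω).1, (hP01 n i ω).1,
          (hI01' n i ω).2, (hP01 n i ω).2]
      have h2 : 0 ≤ r n * ρ := mul_nonneg (hr n).1 hρ.1
      simp only [D]
      rw [abs_mul, abs_of_nonneg h2]
      nlinarith [(hr n).1, hρ.1, hρ.2, abs_nonneg (I n i ω - P n i ω)]
    · intro n
      have e : D i n = (r n * ρ) • (I n i - P n i) := by ext ω; simp [D]
      rw [e]
      have h1 := condExp_smul (μ := μ) (r n * ρ) (I n i - P n i) (F n)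
      have h2 := condExp_sub (hIi n i) (hPi n i) (F n)
      have h3 : μ[P n i | F n] = P n i :=
        condExp_of_stronglyMeasurable (hle n) (hPF n i).stronglyMeasurable (hPi n i)
      filter_upwards [h1, h2, hcI n i] with ω h1 h2 h4
      simp [h1, h2, h3, h4]
  have hmeanP : ∀ n ω, (∑ i, P n i ω) / N = walkMean Z n ω := by
    intro n ω
    simp only [hP, Finset.sum_add_distrib, ← Finset.mul_sum, Finset.sum_const, Finset.card_univ,
      Fintype.card_fin, nsmul_eq_mul]
    simp only [walkMean]
    field_simp
    ring
  have hWdyn : ∀ n ω, walkMean Z (n + 1) ω - q = (1 - (1 - ρ) * r n) * (walkMean Z n ω - q)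
      + (∑ i, D i n ω) / N := by
    intro n ω
    have e1 : (∑ i, D i n ω) / N = r n * ρ * ((∑ i, I n i ω) / N - walkMean Z n ω) := by
      rw [← hmeanP]
      simp only [D, ← Finset.mul_sum, Finset.sum_sub_distrib]
      ring
    have e2 : walkMean Z (n + 1) ω = (1 - r n) * walkMean Z n ω
        + r n * (ρ * ((∑ i, I n i ω) / N) + (1 - ρ) * q) := by
      simp only [walkMean, hdyn, Finset.sum_add_distrib, ← Finset.mul_sum, Finset.sum_const,
        Finset.card_univ, Fintype.card_fin, nsmul_eq_mul]
      field_simp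
    rw [e1, e2]; ring
  have hDdyn : ∀ n i ω, Z (n + 1) i ω - walkMean Z (n + 1) ω
      = (1 - (1 - ρ * (1 - α)) * r n) * (Z n i ω - walkMean Z n ω)
      + (D i n ω - (∑ i, D i n ω) / N) := by
    intro n i ω
    have := hWdyn n ω
    have e : walkMean Z (n + 1) ω = q + ((1 - (1 - ρ) * r n) * (walkMean Z n ω - q)
      + (∑ i, D i n ω) / N) := by linarith
    rw [e, hdyn]
    simp only [D, hP]
    ring
  have hmain : ∀ᵐ ω ∂μ, ∃ L, ∀ i, Tendsto (fun n => Z n i ω) atTop (nhds L) := by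
    filter_upwards [hconv] with ω hω
    choose Lm hLm using hω
    have hbar : Tendsto (fun n => (∑ i, ∑ k ∈ Finset.range n, D i k ω) / N) atTop
        (nhds ((∑ i, Lm i) / N)) := (tendsto_finsetSum _ fun i _ => hLm i).div_const _
    have hbs : ∀ n, (∑ i, D i n ω) / N = (∑ i, ∑ k ∈ Finset.range (n + 1), D i k ω) / N
        - (∑ i, ∑ k ∈ Finset.range n, D i k ω) / N := by
      intro n
      simp only [Finset.sum_range_succ, Finset.sum_add_distrib]
      ring
    have hdiff : ∀ i, Tendsto (fun n => Z n i ω - walkMean Z n ω) atTop (nhds 0) := by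
      intro i
      refine aux_det2 r _ (fun n => ∑ k ∈ Finset.range n, D i k ω
        - (∑ i, ∑ k ∈ Finset.range n, D i k ω) / N) (1 - ρ * (1 - α)) _ (by linarith)
        (fun n => ⟨(hr n).1, ?_⟩) hrdiv ((hLm i).sub hbar) ?_
      · have : 0 ≤ ρ * (1 - α) := mul_nonneg hρ.1 (by linarith [hα.2])
        nlinarith [(hr n).1, (hr n).2]
      · intro n
        rw [hDdyn, hbs, Finset.sum_range_succ]
        ring
    have hWc : ∃ L, Tendsto (fun n => walkMean Z n ω) atTop (nhds L) := by
      rcases hρ.2.lt_or_eq with h1 | h1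
      · have : Tendsto (fun n => walkMean Z n ω - q) atTop (nhds 0) := by
          refine aux_det2 r _ _ (1 - ρ) _ (by linarith)
            (fun n => ⟨(hr n).1, ?_⟩) hrdiv hbar ?_
          · nlinarith [(hr n).1, (hr n).2, hρ.1]
          · intro n
            rw [hWdyn, hbs]
        exact ⟨q, by simpa using this.add_const q⟩
      · have e : ∀ n, walkMean Z n ω = walkMean Z 0 ω
            + (∑ i, ∑ k ∈ Finset.range n, D i k ω) / N := by
          intro n
          induction n with
          | zero => simp
          | succ n ih =>
            have h2 := hWdyn n ω
            rw [h1, hbs] at h2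
            linarith
        refine ⟨walkMean Z 0 ω + (∑ i, Lm i) / N, ?_⟩
        exact (hbar.const_add (walkMean Z 0 ω)).congr fun n => (e n).symm
    obtain ⟨L, hL⟩ := hWc
    exact ⟨L, fun i => by simpa using (hdiff i).add hL⟩
  let Zlim : Ω → ℝ := fun ω => if h : ∃ L, ∀ i, Tendsto (fun n => Z n i ω) atTop (nhds L)
    then h.choose else 0
  have hZl : ∀ᵐ ω ∂μ, ∀ i, Tendsto (fun n => Z n i ω) atTop (nhds (Zlim ω)) := by
    filter_upwards [hmain] with ω h
    simp only [Zlim, dif_pos h]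
    exact h.choose_spec
  have hWl : ∀ᵐ ω ∂μ, Tendsto (fun n => walkMean Z n ω) atTop (nhds (Zlim ω)) := by
    filter_upwards [hZl] with ω h
    have := (tendsto_finsetSum Finset.univ fun i _ => h i).div_const (N : ℝ)
    simpa [walkMean, hN0] using this
  have hPl : ∀ᵐ ω ∂μ, ∀ i, Tendsto (fun n => P n i ω) atTop (nhds (Zlim ω)) := by
    filter_upwards [hZl, hWl] with ω h1 h2 i
    have := ((h1 i).const_mul (1 - α)).add (h2.const_mul α)
    convert this using 2
    ring
  refine ⟨Zlim, ae_all_iff.1 hZl, fun i => ?_, ?_⟩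
  · filter_upwards [hPl] with ω h
    exact (h i).mul ((h i).const_sub 1)
  have hce : ∀ n, μ[(fun ω' => ((∑ i : Fin N, I n i ω') / N - walkMean Z n ω') ^ 2)
      | walkFiltration Z n] =ᵐ[μ] fun ω =>
        (∑ p : Fin N × Fin N, (1 / (N : ℝ) ^ 2) * ∏ k ∈ ({p.1, p.2} : Finset (Fin N)), P n k ω)
        - walkMean Z n ω ^ 2 := by
    intro n
    let A : Fin N × Fin N → Ω → ℝ := fun p =>
      (1 / (N : ℝ) ^ 2) • fun ω => ∏ k ∈ ({p.1, p.2} : Finset (Fin N)), I n k ω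
    let B : Ω → ℝ := ∑ i : Fin N, (1 / (N : ℝ)) • I n i
    let W2 : Ω → ℝ := fun ω => -2 * walkMean Z n ω
    let C : Ω → ℝ := fun ω => walkMean Z n ω ^ 2
    have hWm : Measurable (walkMean Z n) := (hWF n).mono (hle n) le_rfl
    have hAi : ∀ p, Integrable (A p) μ := fun p => (hIprod n _).smul _
    have hBi : Integrable B μ := integrable_finsetSum' _ fun i _ => (hIi n i).smul _
    have hW2b : ∀ ω, ‖W2 ω‖ ≤ 2 := fun ω => by
      simp only [W2, Real.norm_eq_abs, abs_le]
      constructor <;> linarith [(hW01 n ω).1, (hW01 n ω).2]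
    have hW2F : Measurable[F n] W2 := (hWF n).const_mul _
    have hCF : Measurable[F n] C := (hWF n).pow_const 2
    have hCi : Integrable C μ := Integrable.of_bound (hWm.pow_const 2).aestronglyMeasurable 1
      (ae_of_all _ fun ω => by
        simp only [C, Real.norm_eq_abs, abs_le]
        constructor <;> nlinarith [(hW01 n ω).1, (hW01 n ω).2])
    have hWBi : Integrable (W2 * B) μ :=
      hBi.bdd_mul (hWm.const_mul _).aestronglyMeasurable (ae_of_all _ hW2b)
    have hAsi : Integrable (∑ p, A p) μ := integrable_finsetSum' _ fun p _ => hAi p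
    have e : (fun ω' => ((∑ i : Fin N, I n i ω') / N - walkMean Z n ω') ^ 2)
        = (∑ p, A p) + W2 * B + C := by
      ext ω
      have e1 : (∑ p, A p) ω = ((∑ i : Fin N, I n i ω) / N) ^ 2 := by
        rw [Finset.sum_apply, div_pow, sq (∑ i : Fin N, I n i ω), Finset.sum_mul_sum,
          Fintype.sum_prod_type, Finset.sum_div]
        refine Finset.sum_congr rfl fun i _ => ?_
        rw [Finset.sum_div]
        refine Finset.sum_congr rfl fun j _ => ?_
        simp only [A, Pi.smul_apply, smul_eq_mul]
        by_cases hij : i = j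
        · subst hij
          rcases hI01 n i ω with h | h <;> simp [h]
        · rw [Finset.prod_pair hij]; ring
      have e2 : B ω = (∑ i : Fin N, I n i ω) / N := by
        simp only [B, Finset.sum_apply, Pi.smul_apply, smul_eq_mul, ← Finset.mul_sum]
        ring
      simp only [Pi.add_apply, Pi.mul_apply, e1, e2, W2, C]
      ring
    rw [e]
    have c1 := condExp_add (hAsi.add hWBi) hCi (F n)
    have c2 := condExp_add hAsi hWBi (F n)
    have c3 := condExp_finsetSum (s := Finset.univ) (fun p _ => hAi p) (F n)
    have c4 : ∀ᵐ ω ∂μ, ∀ p, (μ[A p | F n]) ω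
        = (1 / (N : ℝ) ^ 2) * ∏ k ∈ ({p.1, p.2} : Finset (Fin N)), P n k ω := by
      rw [ae_all_iff]
      intro p
      filter_upwards [condExp_smul (μ := μ) (1 / (N : ℝ) ^ 2)
        (fun ω => ∏ k ∈ ({p.1, p.2} : Finset (Fin N)), I n k ω) (F n),
        hcond n {p.1, p.2}] with ω h1 h2
      refine h1.trans ?_
      rw [Pi.smul_apply, smul_eq_mul]
      exact congrArg _ h2
    have c5 := condExp_mul_of_stronglyMeasurable_left hW2F.stronglyMeasurable hWBi hBi
    have c6 := condExp_finsetSum (s := Finset.univ)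
      (fun i _ => (hIi n i).smul (1 / (N : ℝ))) (F n)
    have c7 : ∀ᵐ ω ∂μ, ∀ i, (μ[(1 / (N : ℝ)) • I n i | F n]) ω = (1 / (N : ℝ)) * P n i ω := by
      rw [ae_all_iff]
      intro i
      filter_upwards [condExp_smul (μ := μ) (1 / (N : ℝ)) (I n i) (F n), hcI n i] with ω h1 h2
      rw [h1, Pi.smul_apply, smul_eq_mul, h2]
    have c8 : μ[C | F n] = C :=
      condExp_of_stronglyMeasurable (hle n) hCF.stronglyMeasurable hCi
    filter_upwards [c1, c2, c3, c4, c5, c6, c7] with ω c1 c2 c3 c4 c5 c6 c7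
    refine c1.trans ?_
    rw [Pi.add_apply, c8, c2, Pi.add_apply, c3, c5, Pi.mul_apply, c6, Finset.sum_apply,
      Finset.sum_apply]
    simp only [c4, c7]
    have := hmeanP n ω
    have e3 : ∑ i, 1 / (N : ℝ) * P n i ω = walkMean Z n ω := by
      rw [← this, ← Finset.mul_sum]; ring
    rw [e3]
    simp only [W2, C]
    ring
  filter_upwards [ae_all_iff.2 hce, hPl, hWl] with ω h1 h2 h3
  simp_rw [h1]
  have hl : Tendsto (fun n =>
      (∑ p : Fin N × Fin N, (1 / (N : ℝ) ^ 2) * ∏ k ∈ ({p.1, p.2} : Finset (Fin N)), P n k ω)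
        - walkMean Z n ω ^ 2) atTop (nhds
      ((∑ p : Fin N × Fin N, (1 / (N : ℝ) ^ 2) * ∏ k ∈ ({p.1, p.2} : Finset (Fin N)), Zlim ω)
        - Zlim ω ^ 2)) :=
    (tendsto_finsetSum _ fun p _ => (tendsto_finsetProd _ fun k _ => h2 k).const_mul _).sub
      (h3.pow 2)
  convert hl using 2
  have e4 : ∀ i j : Fin N, (1 / (N : ℝ) ^ 2) * ∏ k ∈ ({i, j} : Finset (Fin N)), Zlim ω
      = (1 / (N : ℝ) ^ 2) * (Zlim ω ^ 2 + if i = j then Zlim ω - Zlim ω ^ 2 else 0) := by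
    intro i j
    by_cases hij : i = j
    · subst hij; simp
    · rw [Finset.prod_pair hij, if_neg hij]; ring
  rw [Fintype.sum_prod_type]
  simp only [e4, ← Finset.mul_sum, Finset.sum_add_distrib, Finset.sum_ite_eq, Finset.mem_univ,
    if_true, Finset.sum_const, Finset.card_univ, Fintype.card_fin, nsmul_eq_mul]
  field_simp
  ring
end
end

section
/- Let α ∈ (0,1], let (r_n)_{n≥0} satisfy 0 ≤ r_n < 1, and suppose lim_n n^γ r_n = c for constants c > 0 and γ with either 1/2 < γ < 1, or γ = 1 and 2cα > 1. Define l_n := ∏_{k=0}^{n−1} (1 − α r_k)^{−1}. Then lim_{n→∞} n^γ / l_n² = 0 and Σ_{n≥1} l_n² r_{n−1}² = +∞. -/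
open Filter Real

/-- If `0 ≤ r_n < 1`, `α ∈ (0,1]`, `n^γ r_n → c > 0` with either `1/2 < γ < 1`
or `γ = 1` and `2cα > 1`, then, setting `l_n := ∏_{k<n} (1 - α r_k)⁻¹`, we have
`n^γ / l_n² → 0` and `Σ_{n≥1} l_n² r_{n-1}² = +∞`. -/
theorem stmt_16
    (α c γ : ℝ) (hα : 0 < α ∧ α ≤ 1)
    (r : ℕ → ℝ) (hr : ∀ n, 0 ≤ r n ∧ r n < 1)
    (hc : 0 < c)
    (hγ : (1/2 < γ ∧ γ < 1) ∨ (γ = 1 ∧ 1 < 2 * c * α))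
    (hlim : Tendsto (fun n : ℕ => (n : ℝ) ^ γ * r n) atTop (nhds c))
    (l : ℕ → ℝ)
    (hl : ∀ n, l n = ∏ k ∈ Finset.range n, (1 - α * r k)⁻¹) :
    Tendsto (fun n : ℕ => (n : ℝ) ^ γ / (l n) ^ 2) atTop (nhds 0)
      ∧ ¬ Summable (fun n : ℕ => (l (n + 1)) ^ 2 * (r n) ^ 2) := by
  obtain ⟨hα0, hα1⟩ := hα
  have hγ1 : γ ≤ 1 := by rcases hγ with h | h <;> linarith [h.1, h.2]
  have hpos : ∀ n, 0 < 1 - α * r n := fun n => by nlinarith [(hr n).1, (hr n).2]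
  have hl0 : ∀ n, 0 < l n := fun n => by
    rw [hl]; exact Finset.prod_pos fun k _ => inv_pos.2 (hpos k)
  have hls : ∀ n, l (n + 1) = l n * (1 - α * r n)⁻¹ := fun n => by
    rw [hl, hl, Finset.prod_range_succ]
  have hinv : ∀ n, exp (α * r n) ≤ (1 - α * r n)⁻¹ := fun n => by
    rw [le_inv_comm₀ (exp_pos _) (hpos n), ← Real.exp_neg]
    linarith [Real.add_one_le_exp (-(α * r n))]
  have key : ∃ d : ℝ, γ < d ∧ 0 < d ∧ ∀ᶠ n : ℕ in atTop, d ≤ 2 * α * (n * r n) := by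
    rcases hγ with ⟨h1, h2⟩ | ⟨h1, h2⟩
    · refine ⟨1, h2, one_pos, ?_⟩
      have ht : Tendsto (fun n : ℕ => (n : ℝ) ^ (1 - γ)) atTop atTop :=
        (tendsto_rpow_atTop (by linarith)).comp tendsto_natCast_atTop_atTop
      have ht2 := (ht.atTop_mul_pos hc hlim).const_mul_atTop (show 0 < 2 * α by positivity)
      filter_upwards [ht2.eventually_ge_atTop 1, eventually_gt_atTop 0] with n hn hn0
      have hn0' : (0 : ℝ) < n := by exact_mod_cast hn0
      rw [← mul_assoc ((n : ℝ) ^ (1 - γ)), ← Real.rpow_add hn0'] at hn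
      simpa using hn
    · subst h1
      obtain ⟨d, hd1, hd2⟩ := exists_between h2
      refine ⟨d, hd1, by linarith, ?_⟩
      have ht := hlim.const_mul (2 * α)
      filter_upwards [ht.eventually (lt_mem_nhds (show d < 2 * α * c by linarith))] with n hn
      simp only [Real.rpow_one] at hn
      exact hn.le
  obtain ⟨d, hd, hd0, hev⟩ := key
  obtain ⟨N, hN⟩ := eventually_atTop.1 (hev.and (eventually_gt_atTop 0))
  have hNpos : ∀ n ≥ N, (0 : ℝ) < n := fun n hn => by exact_mod_cast (hN n hn).2
  have hC : 0 < l N ^ 2 / (N : ℝ) ^ d :=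
    div_pos (pow_pos (hl0 N) 2) (Real.rpow_pos_of_pos (hNpos N le_rfl) _)
  set C := l N ^ 2 / (N : ℝ) ^ d with hCdef
  have hmain : ∀ n ≥ N, C * (n : ℝ) ^ d ≤ l n ^ 2 := by
    intro n hn
    induction n, hn using Nat.le_induction with
    | base =>
      rw [hCdef, div_mul_cancel₀ _ (Real.rpow_pos_of_pos (hNpos N le_rfl) _).ne']
    | succ n hn ih =>
      have hn0 := hNpos n hn
      have hb : ((n : ℝ) + 1) ^ d ≤ (n : ℝ) ^ d * ((1 - α * r n)⁻¹) ^ 2 := by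
        have e1 : (n : ℝ) + 1 = n * (1 + 1 / n) := by field_simp
        rw [e1, Real.mul_rpow hn0.le (by positivity)]
        gcongr
        calc (1 + 1 / (n : ℝ)) ^ d ≤ (exp (1 / n)) ^ d := by
              gcongr
              linarith [Real.add_one_le_exp (1 / (n : ℝ))]
          _ = exp (d / n) := by rw [← Real.exp_mul]; congr 1; ring
          _ ≤ exp (2 * (α * r n)) := by
              gcongr
              rw [div_le_iff₀ hn0]
              linarith [(hN n hn).1]
          _ = exp (α * r n) ^ 2 := by rw [← Real.exp_nat_mul]; norm_num
          _ ≤ _ := by gcongr; exact hinv n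
      push_cast
      rw [hls, mul_pow]
      calc C * ((n : ℝ) + 1) ^ d ≤ C * ((n : ℝ) ^ d * ((1 - α * r n)⁻¹) ^ 2) := by gcongr
        _ = C * (n : ℝ) ^ d * ((1 - α * r n)⁻¹) ^ 2 := by ring
        _ ≤ _ := by gcongr
  have first : Tendsto (fun n : ℕ => (n : ℝ) ^ γ / (l n) ^ 2) atTop (nhds 0) := by
    have ht : Tendsto (fun n : ℕ => C⁻¹ * (n : ℝ) ^ (-(d - γ))) atTop (nhds 0) := by
      simpa using ((tendsto_rpow_neg_atTop (by linarith : 0 < d - γ)).comp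
        tendsto_natCast_atTop_atTop).const_mul C⁻¹
    refine squeeze_zero' (Eventually.of_forall fun n => by positivity) ?_ ht
    filter_upwards [eventually_ge_atTop N] with n hn
    have hn0 := hNpos n hn
    rw [div_le_iff₀ (pow_pos (hl0 n) 2)]
    calc (n : ℝ) ^ γ = C⁻¹ * (n : ℝ) ^ (-(d - γ)) * (C * (n : ℝ) ^ d) := by
          rw [show C⁻¹ * (n : ℝ) ^ (-(d - γ)) * (C * (n : ℝ) ^ d)
            = (C⁻¹ * C) * ((n : ℝ) ^ (-(d - γ)) * (n : ℝ) ^ d) by ring,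
            inv_mul_cancel₀ hC.ne', ← Real.rpow_add hn0]
          simp
      _ ≤ _ := by gcongr; exact hmain n hn
  refine ⟨first, fun hs => ?_⟩
  have hns : ¬ Summable (fun n : ℕ => (c / 2) ^ 2 * (1 / (n : ℝ))) := by
    rw [summable_mul_left_iff (by positivity)]
    exact Real.not_summable_one_div_natCast
  apply hns
  refine summable_of_isBigO_nat hs (Asymptotics.IsBigO.of_bound 1 ?_)
  filter_upwards [first.eventually (gt_mem_nhds one_pos), eventually_ge_atTop 1,
    hlim.eventually (lt_mem_nhds (show c / 2 < c by linarith))] with n h1 h2 h3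
  have hn1 : (1 : ℝ) ≤ n := by exact_mod_cast h2
  have hn0 : (0 : ℝ) < n := by linarith
  rw [div_lt_one (pow_pos (hl0 n) 2)] at h1
  rw [Real.norm_of_nonneg (by positivity), Real.norm_of_nonneg (by positivity), one_mul]
  have hmono : l n ≤ l (n + 1) := by
    rw [hls]
    apply le_mul_of_one_le_right (hl0 n).le
    exact (Real.one_le_exp (mul_nonneg hα0.le (hr n).1)).trans (hinv n)
  have hp : 0 < (n : ℝ) ^ γ := Real.rpow_pos_of_pos hn0 _
  have hp1 : (n : ℝ) ^ γ ≤ n := by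
    simpa using Real.rpow_le_rpow_of_exponent_le hn1 hγ1
  calc (c / 2) ^ 2 * (1 / (n : ℝ)) ≤ ((n : ℝ) ^ γ * r n) ^ 2 * (1 / (n : ℝ) ^ γ) := by gcongr
    _ = (n : ℝ) ^ γ * r n ^ 2 := by field_simp
    _ ≤ l n ^ 2 * r n ^ 2 := by gcongr
    _ ≤ _ := by
      have := (hl0 n).le
      gcongr
end

section
/- Let α ∈ (0,1], let (r_n)_{n≥0} satisfy 0 ≤ r_n < 1, and define l_n := ∏_{k=0}^{n−1} (1 − α r_k)^{−1}. Suppose lim_n n^γ r_n = c with c > 0. Then: (i) if 1/2 < γ < 1, then lim_{n→∞} (n^γ / l_n²) Σ_{k=1}^{n} l_k² r_{k−1}² = c/(2α); (ii) if γ = 1 and 2cα > 1, then lim_{n→∞} (n / l_n²) Σ_{k=1}^{n} l_k² r_{k−1}² = c²/(2cα − 1). -/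
open Filter Real

lemma aux_conv (x b d w : ℕ → ℝ) (B D : ℝ) (hB : 0 < B)
    (hx : ∀ᶠ n in atTop, x (n+1) = (1 - b n) * x n + d n)
    (hb : Tendsto (fun n => w n * b n) atTop (nhds B))
    (hd : Tendsto (fun n => w n * d n) atTop (nhds D))
    (hw : Tendsto w atTop atTop) (hwn : ∀ᶠ n : ℕ in atTop, w n ≤ n) :
    Tendsto x atTop (nhds (D / B)) := by
  set L := D / B with hL
  have hb0 : Tendsto b atTop (nhds 0) := by
    have h := hb.mul hw.inv_tendsto_atTop
    rw [mul_zero] at h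
    refine h.congr' ?_
    filter_upwards [hw.eventually_gt_atTop 0] with n hn
    simp only [Pi.inv_apply]
    field_simp
  have he : Tendsto (fun n => |w n * (d n - b n * L)|) atTop (nhds 0) := by
    have h := (hd.sub (hb.mul_const L)).abs
    have h0 : D - B * L = 0 := by rw [hL]; field_simp; ring
    rw [h0, abs_zero] at h
    refine h.congr fun n => ?_
    congr 1; ring
  have hH : Tendsto (fun n : ℕ => ∑ i ∈ Finset.range n, 1 / ((i:ℝ) + 1)) atTop atTop :=
    tendsto_sum_range_one_div_nat_succ_atTop
  set H : ℕ → ℝ := fun n : ℕ => ∑ i ∈ Finset.range n, 1 / ((i:ℝ) + 1) with hHd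
  rw [Metric.tendsto_atTop']
  intro ε hε
  have hev : ∀ᶠ n : ℕ in atTop, |x (n+1) - L| ≤ (1 - b n) * |x n - L| + b n * (ε/2) ∧ b n ≤ 1 ∧
      B / 2 * (1 / ((n:ℝ)+1)) ≤ b n := by
    filter_upwards [hx, hb.eventually (lt_mem_nhds (show B/2 < B by linarith)),
      hb0.eventually (gt_mem_nhds (show (0:ℝ) < 1 by norm_num)),
      he.eventually (gt_mem_nhds (show (0:ℝ) < B/2 * (ε/2) by positivity)),
      hw.eventually_gt_atTop 0, hwn] with n h1 h2 h3 h4 h5 h6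
    have hbn : B / 2 * (1 / ((n:ℝ)+1)) ≤ b n := by
      rw [mul_one_div, div_le_iff₀ (by positivity)]
      have : 0 < b n := by
        by_contra hneg
        push Not at hneg
        nlinarith
      nlinarith
    refine ⟨?_, h3.le, hbn⟩
    have h7 : |d n - b n * L| ≤ b n * (ε/2) := by
      rw [abs_mul, abs_of_pos h5] at h4
      have : w n * |d n - b n * L| ≤ w n * (b n * (ε/2)) := by nlinarith
      exact le_of_mul_le_mul_left this h5
    have : x (n+1) - L = (1 - b n) * (x n - L) + (d n - b n * L) := by rw [h1]; ring
    rw [this]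
    refine (abs_add_le _ _).trans ?_
    rw [abs_mul, abs_of_nonneg (by linarith : 0 ≤ 1 - b n)]
    linarith
  obtain ⟨N, hN⟩ := eventually_atTop.1 hev
  set C := |x N - L| * exp (B/2 * H N) with hC
  have hC0 : 0 ≤ C := by positivity
  have key : ∀ n ≥ N, |x n - L| ≤ ε/2 + C * exp (-(B/2 * H n)) := by
    intro n hn
    induction n, hn using Nat.le_induction with
    | base =>
      rw [hC, mul_assoc, ← exp_add]
      simp; positivity
    | succ n hn ih =>
      obtain ⟨h1, h2, h3⟩ := hN n hn
      have hs : H (n+1) = H n + 1 / ((n:ℝ)+1) := by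
        simp only [hHd]; rw [Finset.sum_range_succ]
      have h4 : 1 - b n ≤ exp (-(B/2 * (1 / ((n:ℝ)+1)))) := by
        have := add_one_le_exp (-(B/2 * (1 / ((n:ℝ)+1))))
        linarith
      have h5 : exp (-(B/2 * H (n+1))) = exp (-(B/2 * (1 / ((n:ℝ)+1)))) * exp (-(B/2 * H n)) := by
        rw [← exp_add, hs]; congr 1; ring
      rw [h5]
      have h6 : (1 - b n) * |x n - L| ≤ (1 - b n) * (ε/2 + C * exp (-(B/2 * H n))) :=
        mul_le_mul_of_nonneg_left ih (by linarith)
      have h7 := mul_le_mul_of_nonneg_right h4 (mul_nonneg hC0 (exp_pos (-(B/2 * H n))).le)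
      nlinarith
  have hlim : Tendsto (fun n => C * exp (-(B/2 * H n))) atTop (nhds 0) := by
    have := (tendsto_exp_neg_atTop_nhds_zero.comp
      (hH.const_mul_atTop (show 0 < B/2 by positivity))).const_mul C
    simpa using this
  obtain ⟨M, hM⟩ := eventually_atTop.1 
    ((hlim.eventually (gt_mem_nhds (show 0 < ε/2 by positivity))).and (eventually_ge_atTop N))
  refine ⟨M, fun n hn => ?_⟩
  obtain ⟨h1, h2⟩ := hM n hn.le
  rw [Real.dist_eq]
  linarith [key n h2]

lemma aux_core (α c γ κ : ℝ) (hα : 0 < α ∧ α ≤ 1)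
    (r : ℕ → ℝ) (hr : ∀ n, 0 ≤ r n ∧ r n < 1)
    (hlim : Tendsto (fun n : ℕ => (n : ℝ) ^ γ * r n) atTop (nhds c))
    (l : ℕ → ℝ)
    (hl : ∀ n, l n = ∏ k ∈ Finset.range n, (1 - α * r k)⁻¹)
    (hγ : 0 < γ) (hγ1 : γ ≤ 1) (hκ : κ < 2 * c * α)
    (hq : Tendsto (fun n : ℕ => (n:ℝ)^γ * ((((n:ℝ)+1)/n)^γ - 1)) atTop (nhds κ)) :
    Tendsto (fun n : ℕ =>
          ((n : ℝ) ^ γ / (l n) ^ 2) *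
            ∑ k ∈ Finset.range n, (l (k + 1)) ^ 2 * (r k) ^ 2)
        atTop (nhds (c ^ 2 / (2 * c * α - κ))) := by
  have hw : Tendsto (fun n : ℕ => (n:ℝ)^γ) atTop atTop :=
    (tendsto_rpow_atTop hγ).comp tendsto_natCast_atTop_atTop
  have hdiv : ∀ f : ℕ → ℝ, ∀ a : ℝ, Tendsto (fun n : ℕ => (n:ℝ)^γ * f n) atTop (nhds a) →
      Tendsto f atTop (nhds 0) := by
    intro f a hf
    have h := hf.mul hw.inv_tendsto_atTop
    rw [mul_zero] at h
    refine h.congr' ?_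
    filter_upwards [hw.eventually_gt_atTop 0] with n hn
    simp only [Pi.inv_apply]
    field_simp
  have hr0 := hdiv r c hlim
  have hq1 : Tendsto (fun n : ℕ => (((n:ℝ)+1)/n)^γ) atTop (nhds 1) := by
    have := (hdiv _ _ hq).add_const 1
    simpa using this
  have hpos : ∀ n, 0 < 1 - α * r n := fun n => by
    have := hr n
    nlinarith [hα.1, hα.2]
  have hlpos : ∀ n, 0 < l n := fun n => by
    rw [hl]; exact Finset.prod_pos fun k _ => inv_pos.2 (hpos k)
  have hls : ∀ n, l (n+1) = l n * (1 - α * r n)⁻¹ := fun n => by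
    rw [hl, hl, Finset.prod_range_succ]
  refine aux_conv _ (fun n => 1 - (((n:ℝ)+1)/n)^γ * (1 - α * r n)^2)
    (fun n => ((n:ℝ)+1)^γ * (r n)^2) (fun n => (n:ℝ)^γ) _ _ (by linarith) ?_ ?_ ?_ hw ?_
  · filter_upwards [eventually_gt_atTop 0] with n hn
    have hn' : (0:ℝ) < n := by exact_mod_cast hn
    rw [Finset.sum_range_succ, hls n, div_rpow (by positivity) hn'.le]
    have h1 := (hpos n).ne'
    have h2 := (hlpos n).ne'
    have h3 := (rpow_pos_of_pos hn' γ).ne'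
    push_cast
    field_simp
    ring
  · have h := (hq1.mul ((hlim.const_mul (2*α)).sub ((hlim.mul hr0).const_mul (α^2)))).sub hq
    have e : 1 * (2 * α * c - α^2 * (c * 0)) - κ = 2 * c * α - κ := by ring
    rw [e] at h
    refine h.congr fun n => ?_
    ring
  · have h := hq1.mul (hlim.pow 2)
    rw [one_mul] at h
    refine h.congr' ?_
    filter_upwards [eventually_gt_atTop 0] with n hn
    have hn' : (0:ℝ) < n := by exact_mod_cast hn
    rw [div_rpow (by positivity) hn'.le]
    have h3 := (rpow_pos_of_pos hn' γ).ne'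
    field_simp
  · filter_upwards [eventually_ge_atTop 1] with n hn
    have hn' : (1:ℝ) ≤ n := by exact_mod_cast hn
    simpa using rpow_le_rpow_of_exponent_le hn' hγ1

/-- Asymptotics of the weighted sums `Σ_{k=1}^n l_k² r_{k-1}²`, where
`l_n := ∏_{k<n} (1 - α r_k)⁻¹` and `n^γ r_n → c > 0`:
(i) if `1/2 < γ < 1`, then `(n^γ / l_n²) Σ_{k=1}^n l_k² r_{k-1}² → c/(2α)`;
(ii) if `γ = 1` and `2cα > 1`, then `(n / l_n²) Σ_{k=1}^n l_k² r_{k-1}² → c²/(2cα - 1)`. -/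
theorem stmt_17
    (α c γ : ℝ) (hα : 0 < α ∧ α ≤ 1)
    (r : ℕ → ℝ) (hr : ∀ n, 0 ≤ r n ∧ r n < 1)
    (hc : 0 < c)
    (hlim : Tendsto (fun n : ℕ => (n : ℝ) ^ γ * r n) atTop (nhds c))
    (l : ℕ → ℝ)
    (hl : ∀ n, l n = ∏ k ∈ Finset.range n, (1 - α * r k)⁻¹) :
    ((1/2 < γ ∧ γ < 1) →
      Tendsto (fun n : ℕ =>
          ((n : ℝ) ^ γ / (l n) ^ 2) *
            ∑ k ∈ Finset.range n, (l (k + 1)) ^ 2 * (r k) ^ 2)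
        atTop (nhds (c / (2 * α))))
    ∧ ((γ = 1 ∧ 1 < 2 * c * α) →
      Tendsto (fun n : ℕ =>
          ((n : ℝ) / (l n) ^ 2) *
            ∑ k ∈ Finset.range n, (l (k + 1)) ^ 2 * (r k) ^ 2)
        atTop (nhds (c ^ 2 / (2 * c * α - 1)))) := by
  constructor
  · rintro ⟨h1, h2⟩
    have hγ : 0 < γ := by linarith
    have h := aux_core α c γ 0 hα r hr hlim l hl hγ h2.le (by nlinarith [mul_pos hc hα.1]) ?_
    · have e : c ^ 2 / (2 * c * α - 0) = c / (2 * α) := by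
        have := hα.1
        rw [sub_zero]; field_simp
      rwa [e] at h
    · have hz : Tendsto (fun n : ℕ => (n:ℝ)^(-(1-γ))) atTop (nhds 0) :=
        (tendsto_rpow_neg_atTop (by linarith)).comp tendsto_natCast_atTop_atTop
      refine squeeze_zero' ?_ ?_ hz
      · filter_upwards [eventually_ge_atTop 1] with n hn
        have hn' : (1:ℝ) ≤ n := by exact_mod_cast hn
        have : 1 ≤ (((n:ℝ)+1)/n)^γ :=
          one_le_rpow (by rw [le_div_iff₀ (by linarith)]; linarith) hγ.le
        exact mul_nonneg (by positivity) (by linarith)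
      · filter_upwards [eventually_ge_atTop 1] with n hn
        have hn' : (1:ℝ) ≤ n := by exact_mod_cast hn
        have hn0 : (0:ℝ) < n := by linarith
        have h3 : (((n:ℝ)+1)/n)^γ ≤ ((n:ℝ)+1)/n := by
          simpa using rpow_le_rpow_of_exponent_le
            (show 1 ≤ ((n:ℝ)+1)/n by rw [le_div_iff₀ hn0]; linarith) h2.le
        have h4 : ((n:ℝ)+1)/n - 1 = (n:ℝ)^(-1:ℝ) := by
          rw [rpow_neg_one]; field_simp; ring
        have h5 : -(1-γ) = γ + (-1) := by ring
        rw [h5, rpow_add hn0, ← h4]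
        gcongr
  · rintro ⟨h1, h2⟩
    subst h1
    have h := aux_core α c 1 1 hα r hr hlim l hl one_pos le_rfl h2 ?_
    · simpa only [rpow_one] using h
    · refine tendsto_const_nhds.congr' ?_
      filter_upwards [eventually_ge_atTop 1] with n hn
      have hn' : (1:ℝ) ≤ n := by exact_mod_cast hn
      simp only [rpow_one]
      field_simp
      ring
end

section
/- Suppose ρ = 1, α > 0, and lim_n n^γ r_n = c for some constants c > 0 and γ ∈ (1/2, 1]. Then for every ε > 0, almost surely n^{−(1/2+ε)(2γ−1)} Σ_{k=1}^{n} k^{2γ−1} (Z_k − Z_{k−1}) → 0 as n → ∞; i.e. the martingale-transform sums Σ_{k=1}^{n} k^{2γ−1}(Z_k − Z_{k−1}) are o(n^{(1/2+ε)(2γ−1)}) almost surely. -/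
open MeasureTheory Filter Real

noncomputable section

theorem aux_kronecker (β : ℝ) (hβ : 0 < β) (M : ℕ → ℝ) (L : ℝ)
    (hM : Tendsto M atTop (nhds L)) :
    Tendsto (fun n : ℕ => (n : ℝ) ^ (-β) *
      ∑ k ∈ Finset.range n, ((k : ℝ) + 1) ^ β * (M (k + 1) - M k)) atTop (nhds 0) := by
  have hid : ∀ n : ℕ, ∑ k ∈ Finset.range n, ((k : ℝ) + 1) ^ β * (M (k + 1) - M k)
      = (n : ℝ) ^ β * (M n - L)
        - ∑ k ∈ Finset.range n, (((k : ℝ) + 1) ^ β - (k : ℝ) ^ β) * (M k - L) := by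
    intro n
    induction n with
    | zero => simp [Real.zero_rpow hβ.ne']
    | succ n ih =>
      rw [Finset.sum_range_succ, Finset.sum_range_succ, ih]
      push_cast
      ring
  have hsum : ∀ n : ℕ, ∑ k ∈ Finset.range n, (((k : ℝ) + 1) ^ β - (k : ℝ) ^ β) = (n : ℝ) ^ β := by
    intro n
    induction n with
    | zero => simp [Real.zero_rpow hβ.ne']
    | succ n ih =>
      rw [Finset.sum_range_succ, ih]
      push_cast
      ring
  have hML : Tendsto (fun n => M n - L) atTop (nhds 0) := by
    simpa using hM.sub_const L
  have hlo : (fun k : ℕ => (((k : ℝ) + 1) ^ β - (k : ℝ) ^ β) * (M k - L)) =o[atTop]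
      (fun k : ℕ => ((k : ℝ) + 1) ^ β - (k : ℝ) ^ β) := by
    have h1 : (fun n => M n - L) =o[atTop] (fun _ : ℕ => (1 : ℝ)) :=
      (Asymptotics.isLittleO_one_iff ℝ).2 hML
    simpa using (Asymptotics.isBigO_refl
      (fun k : ℕ => ((k : ℝ) + 1) ^ β - (k : ℝ) ^ β) atTop).mul_isLittleO h1
  have hs := hlo.sum_range
    (fun k => sub_nonneg.2 (Real.rpow_le_rpow (Nat.cast_nonneg k) (by linarith) hβ.le))
    (by
      simp_rw [hsum]
      exact (tendsto_rpow_atTop hβ).comp tendsto_natCast_atTop_atTop)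
  simp_rw [hsum] at hs
  have hs' := hs.tendsto_div_nhds_zero
  have h2 := hML.sub hs'
  rw [sub_zero] at h2
  refine h2.congr' ?_
  filter_upwards [eventually_gt_atTop 0] with n hn
  rw [hid, Real.rpow_neg (Nat.cast_nonneg n)]
  have : (0 : ℝ) < (n : ℝ) ^ β := Real.rpow_pos_of_pos (by exact_mod_cast hn) _
  field_simp

theorem aux_conv_s19 {Ω : Type*} {m0 : MeasurableSpace Ω} (μ : Measure Ω) [IsProbabilityMeasure μ]
    (F : Filtration ℕ m0) (X : ℕ → Ω → ℝ) (v : ℕ → ℝ)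
    (hX : ∀ k, Measurable[F (k + 1)] (X k))
    (hb : ∀ k ω, |X k ω| ≤ v k) (hv : Summable (fun k => v k ^ 2))
    (hc : ∀ k, μ[X k | F k] =ᵐ[μ] 0) :
    ∀ᵐ ω ∂μ, ∃ L, Tendsto (fun n => ∑ k ∈ Finset.range n, X k ω) atTop (nhds L) := by
  set M : ℕ → Ω → ℝ := fun n ω => ∑ k ∈ Finset.range n, X k ω with hMdef
  have hMm : ∀ n, Measurable[F n] (M n) := by
    intro n
    refine Finset.measurable_fun_sum _ fun k hk => ?_
    exact (hX k).mono (F.mono (Finset.mem_range.1 hk)) le_rfl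
  have hMm0 : ∀ n, Measurable (M n) := fun n => (hMm n).mono (F.le n) le_rfl
  have hXm0 : ∀ n, Measurable (X n) := fun n => (hX n).mono (F.le _) le_rfl
  have hMb : ∀ n ω, |M n ω| ≤ ∑ k ∈ Finset.range n, v k := fun n ω =>
    (Finset.abs_sum_le_sum_abs _ _).trans (Finset.sum_le_sum fun k _ => hb k ω)
  have hint : ∀ (f : Ω → ℝ) (C : ℝ), Measurable f → (∀ ω, |f ω| ≤ C) → Integrable f μ :=
    fun f C hf hC => Integrable.of_bound hf.aestronglyMeasurable C
      (Eventually.of_forall fun ω => by simpa using hC ω)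
  have hMi : ∀ n, Integrable (M n) μ := fun n => hint _ _ (hMm0 n) (hMb n)
  have hXi : ∀ n, Integrable (X n) μ := fun n => hint _ _ (hXm0 n) (hb n)
  have hv0 : ∀ k, 0 ≤ v k := fun k => by
    obtain ⟨ω⟩ := nonempty_of_isProbabilityMeasure μ
    exact (abs_nonneg _).trans (hb k ω)
  have hMXi : ∀ n, Integrable (M n * X n) μ := fun n =>
    hint _ ((∑ k ∈ Finset.range n, v k) * v n) ((hMm0 n).mul (hXm0 n)) fun ω => by
      rw [Pi.mul_apply, abs_mul]
      exact mul_le_mul (hMb n ω) (hb n ω) (abs_nonneg _) (Finset.sum_nonneg fun k _ => hv0 k)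
  have hM2i : ∀ n, Integrable (fun ω => M n ω ^ 2) μ := fun n =>
    hint _ ((∑ k ∈ Finset.range n, v k) ^ 2) ((hMm0 n).pow_const 2) fun ω => by
      rw [abs_pow]
      exact pow_le_pow_left₀ (abs_nonneg _) (hMb n ω) 2
  have hX2i : ∀ n, Integrable (fun ω => X n ω ^ 2) μ := fun n =>
    hint _ ((v n) ^ 2) ((hXm0 n).pow_const 2) fun ω => by
      rw [abs_pow]
      exact pow_le_pow_left₀ (abs_nonneg _) (hb n ω) 2
  have hMs : ∀ n ω, M (n + 1) ω = M n ω + X n ω := fun n ω => Finset.sum_range_succ _ _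
  have horth : ∀ n, ∫ ω, M n ω * X n ω ∂μ = 0 := by
    intro n
    have h1 : μ[M n * X n | F n] =ᵐ[μ] M n * μ[X n | F n] :=
      condExp_mul_of_stronglyMeasurable_left (hMm n).stronglyMeasurable (hMXi n) (hXi n)
    have h2 : μ[M n * X n | F n] =ᵐ[μ] 0 := by
      filter_upwards [h1, hc n] with ω a b
      rw [a, Pi.mul_apply, b]; simp
    have h3 := integral_condExp (μ := μ) (f := M n * X n) (F.le n)
    rw [integral_congr_ae h2] at h3
    simpa using h3.symm
  have hV : ∀ n, ∫ ω, M n ω ^ 2 ∂μ ≤ ∑ k ∈ Finset.range n, v k ^ 2 := by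
    intro n
    induction n with
    | zero => simp [hMdef]
    | succ n ih =>
      have e : ∀ ω, M (n + 1) ω ^ 2 = M n ω ^ 2 + (2 * (M n ω * X n ω) + X n ω ^ 2) := by
        intro ω; rw [hMs]; ring
      simp_rw [e]
      have i1 : Integrable (fun ω => 2 * (M n ω * X n ω)) μ := (hMXi n).const_mul 2
      have i2 : Integrable (fun ω => 2 * (M n ω * X n ω) + X n ω ^ 2) μ := i1.add (hX2i n)
      rw [integral_add (hM2i n) i2, integral_add i1 (hX2i n),
        integral_const_mul, horth, Finset.sum_range_succ]
      have : ∫ ω, X n ω ^ 2 ∂μ ≤ ∫ ω, v n ^ 2 ∂μ := by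
        refine integral_mono (hX2i n) (integrable_const _) fun ω => ?_
        exact sq_le_sq' (abs_le.1 (hb n ω)).1 (abs_le.1 (hb n ω)).2
      simp at this
      linarith
  have hmart : Martingale M F μ := by
    refine martingale_of_condExp_sub_eq_zero_nat (fun n => (hMm n).stronglyMeasurable) hMi ?_
    intro n
    have : M (n + 1) - M n = X n := by
      ext ω; simp [hMs]
    rw [this]; exact hc n
  set R : ℝ := 1 + ∑' k, v k ^ 2
  refine hmart.submartingale.exists_ae_tendsto_of_bdd (R := R.toNNReal) fun n => ?_
  rw [eLpNorm_one_eq_lintegral_enorm, ← ofReal_integral_norm_eq_lintegral_enorm (hMi n)]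
  refine ENNReal.ofReal_le_ofReal ?_
  calc ∫ ω, ‖M n ω‖ ∂μ ≤ ∫ ω, (1 + M n ω ^ 2) ∂μ := by
        refine integral_mono (hMi n).norm ((integrable_const _).add (hM2i n)) fun ω => ?_
        simp only [Real.norm_eq_abs]
        nlinarith [sq_abs (M n ω), sq_nonneg (|M n ω| - 1), abs_nonneg (M n ω)]
    _ = 1 + ∫ ω, M n ω ^ 2 ∂μ := by
        rw [integral_add (integrable_const _) (hM2i n)]; simp
    _ ≤ R := by
        have := hv.sum_le_tsum (Finset.range n) (fun k _ => sq_nonneg _)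
        have := hV n
        simp only [R]; linarith

theorem aux_summable (r : ℕ → ℝ) (hr : ∀ n, 0 ≤ r n ∧ r n < 1)
    (c γ : ℝ) (hγ : 1/2 < γ ∧ γ ≤ 1)
    (hlim : Tendsto (fun n : ℕ => (n : ℝ) ^ γ * r n) atTop (nhds c)) (ε : ℝ) (hε : 0 < ε) :
    Summable (fun k : ℕ => (((k : ℝ) + 1) ^ ((1/2 - ε) * (2 * γ - 1)) * r k) ^ 2) := by
  obtain ⟨C, hC⟩ := hlim.bddAbove_range
  have hC' : ∀ n : ℕ, (n : ℝ) ^ γ * r n ≤ C := fun n => hC ⟨n, rfl⟩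
  have hK : ∀ n : ℕ, ((n : ℝ) + 1) ^ γ * r n ≤ C + 1 := by
    intro n
    have h1 : ((n : ℝ) + 1) ^ γ ≤ (n : ℝ) ^ γ + 1 ^ γ :=
      Real.rpow_add_le_add_rpow (Nat.cast_nonneg n) zero_le_one (by linarith [hγ.1]) hγ.2
    rw [Real.one_rpow] at h1
    have := mul_le_mul_of_nonneg_right h1 (hr n).1
    linarith [hC' n, (hr n).2]
  have hs : Summable (fun k : ℕ => (C + 1) ^ 2 * ((k : ℝ) + 1) ^ (-1 - 2 * ε * (2 * γ - 1))) := by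
    refine Summable.mul_left _ ?_
    have h0 : Summable (fun k : ℕ => (k : ℝ) ^ (-1 - 2 * ε * (2 * γ - 1))) :=
      Real.summable_nat_rpow.2 (by nlinarith [mul_pos hε (by linarith [hγ.1] : 0 < 2 * γ - 1)])
    simpa using (summable_nat_add_iff 1).2 h0
  refine hs.of_nonneg_of_le (fun k => sq_nonneg _) fun k => ?_
  have hk : (0 : ℝ) < (k : ℝ) + 1 := by positivity
  have e1 : ((k : ℝ) + 1) ^ ((1/2 - ε) * (2 * γ - 1))
      = ((k : ℝ) + 1) ^ ((1/2 - ε) * (2 * γ - 1) - γ) * ((k : ℝ) + 1) ^ γ := by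
    rw [← Real.rpow_add hk]; congr 1; ring
  have e2 : ((k : ℝ) + 1) ^ (-1 - 2 * ε * (2 * γ - 1))
      = (((k : ℝ) + 1) ^ ((1/2 - ε) * (2 * γ - 1) - γ)) ^ 2 := by
    rw [sq, ← Real.rpow_add hk]; congr 1; ring
  rw [e1, e2, mul_assoc, mul_pow, mul_comm]
  have h3 : 0 ≤ ((k : ℝ) + 1) ^ γ * r k := mul_nonneg (Real.rpow_nonneg hk.le _) (hr k).1
  exact mul_le_mul_of_nonneg_right (pow_le_pow_left₀ h3 (hK k) 2) (sq_nonneg _)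

theorem aux_mean01 {Ω : Type*} {N : ℕ} (hN : 1 ≤ N) (Z : ℕ → Fin N → Ω → ℝ)
    (h : ∀ n i ω, Z n i ω ∈ Set.Icc (0:ℝ) 1) (n : ℕ) (ω : Ω) :
    walkMean Z n ω ∈ Set.Icc (0:ℝ) 1 := by
  have hN0 : (0 : ℝ) < N := by exact_mod_cast hN
  unfold walkMean
  refine ⟨div_nonneg (Finset.sum_nonneg fun i _ => (h n i ω).1) hN0.le, ?_⟩
  rw [div_le_one hN0]
  calc ∑ i : Fin N, Z n i ω ≤ ∑ i : Fin N, (1 : ℝ) := Finset.sum_le_sum fun i _ => (h n i ω).2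
    _ = N := by simp

theorem aux_meas {Ω : Type*} [MeasurableSpace Ω] {N : ℕ} (Z : ℕ → Fin N → Ω → ℝ)
    (k n : ℕ) (hkn : k ≤ n) (i : Fin N) : Measurable[walkFiltration Z n] (Z k i) := by
  refine Measurable.of_comap_le ?_
  unfold walkFiltration
  exact le_iSup₂_of_le k (Finset.mem_range.2 (by omega)) (le_iSup_of_le i le_rfl)

theorem aux_mean_meas {Ω : Type*} [MeasurableSpace Ω] {N : ℕ} (Z : ℕ → Fin N → Ω → ℝ)
    (k n : ℕ) (hkn : k ≤ n) : Measurable[walkFiltration Z n] (walkMean Z k) := by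
  unfold walkMean
  exact (Finset.measurable_fun_sum _ fun i _ => aux_meas Z k n hkn i).div_const _

theorem aux_cond {Ω : Type*} [MeasurableSpace Ω] (μ : Measure Ω) [IsProbabilityMeasure μ]
    {N : ℕ} (hN : 1 ≤ N) (α : ℝ) (Z I : ℕ → Fin N → Ω → ℝ)
    (hle : ∀ n, walkFiltration Z n ≤ ‹MeasurableSpace Ω›)
    (hImeas : ∀ n i, Measurable (I n i))
    (hZ01 : ∀ n i ω, Z n i ω ∈ Set.Icc (0:ℝ) 1)
    (hI01 : ∀ n i ω, I n i ω ∈ Set.Icc (0:ℝ) 1)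
    (hcond : ∀ n (s : Finset (Fin N)),
      μ[(fun ω => ∏ i ∈ s, I n i ω) | walkFiltration Z n]
        =ᵐ[μ] fun ω => ∏ i ∈ s, ((1 - α) * Z n i ω + α * walkMean Z n ω))
    (n : ℕ) (a : ℝ) :
    μ[fun ω => a * (walkMean I n ω - walkMean Z n ω) | walkFiltration Z n] =ᵐ[μ] 0 := by
  have hN0 : (0 : ℝ) < N := by exact_mod_cast hN
  have hIi : ∀ i, Integrable (I n i) μ := fun i =>
    Integrable.of_bound (hImeas n i).aestronglyMeasurable 1
      (Eventually.of_forall fun ω => by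
        rw [Real.norm_eq_abs, abs_of_nonneg (hI01 n i ω).1]; exact (hI01 n i ω).2)
  have hZm := aux_mean_meas Z n n le_rfl
  have hZi : Integrable (walkMean Z n) μ :=
    Integrable.of_bound (hZm.mono (hle n) le_rfl).aestronglyMeasurable 1
      (Eventually.of_forall fun ω => by
        have := aux_mean01 hN Z hZ01 n ω
        rw [Real.norm_eq_abs, abs_of_nonneg this.1]; exact this.2)
  have hIe : walkMean I n = (N : ℝ)⁻¹ • ∑ i, I n i := by
    ext ω; simp [walkMean, div_eq_inv_mul]
  have hSi : Integrable (∑ i, I n i) μ := integrable_finsetSum' _ fun i _ => hIi i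
  have e : (fun ω => a * (walkMean I n ω - walkMean Z n ω))
      = a • ((N : ℝ)⁻¹ • (∑ i, I n i) - walkMean Z n) := by
    rw [← hIe]; rfl
  rw [e]
  have c1 := condExp_smul (μ := μ) a ((N : ℝ)⁻¹ • (∑ i, I n i) - walkMean Z n)
    (walkFiltration Z n)
  have c2 := condExp_sub (μ := μ) (hSi.smul (N : ℝ)⁻¹) hZi (walkFiltration Z n)
  have c3 := condExp_smul (μ := μ) (N : ℝ)⁻¹ (∑ i, I n i) (walkFiltration Z n)
  have c4 := condExp_finsetSum (μ := μ) (s := Finset.univ) (f := I n) (fun i _ => hIi i)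
    (walkFiltration Z n)
  have c5 : μ[walkMean Z n | walkFiltration Z n] = walkMean Z n :=
    condExp_of_stronglyMeasurable (hle n) hZm.stronglyMeasurable hZi
  have c6 : ∀ᵐ ω ∂μ, ∀ i, (μ[I n i | walkFiltration Z n]) ω
      = (1 - α) * Z n i ω + α * walkMean Z n ω := by
    rw [ae_all_iff]
    intro i
    have := hcond n {i}
    simp only [Finset.prod_singleton] at this
    exact this
  filter_upwards [c1, c2, c3, c4, c6] with ω h1 h2 h3 h4 h6
  rw [h1, Pi.smul_apply, h2, Pi.sub_apply, h3, Pi.smul_apply, h4, c5, Finset.sum_apply]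
  simp_rw [h6]
  rw [Finset.sum_add_distrib, ← Finset.mul_sum]
  have hs : ∑ i, Z n i ω = N * walkMean Z n ω := by
    unfold walkMean; field_simp
  rw [hs]
  simp
  right
  field_simp
  ring

/-- **Almost sure growth bound**: for `ρ = 1`, `α > 0` and `n^γ r_n → c > 0` with
`1/2 < γ ≤ 1`, for every `ε > 0` the sums `Σ_{k=1}^n k^{2γ-1}(Z_k - Z_{k-1})`
are `o(n^{(1/2+ε)(2γ-1)})` almost surely. -/
theorem stmt_19
    {Ω : Type*} [MeasurableSpace Ω] (μ : Measure Ω) [IsProbabilityMeasure μ]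
    (N : ℕ) (hN : 1 ≤ N)
    (ρ α q : ℝ)
    (hρ : ρ ∈ Set.Icc (0:ℝ) 1) (hα : α ∈ Set.Icc (0:ℝ) 1) (hq : q ∈ Set.Icc (0:ℝ) 1)
    (r : ℕ → ℝ) (hr : ∀ n, 0 ≤ r n ∧ r n < 1)
    (Z : ℕ → Fin N → Ω → ℝ) (I : ℕ → Fin N → Ω → ℝ)
    (hZmeas : ∀ n i, Measurable (Z n i))
    (hImeas : ∀ n i, Measurable (I n i))
    (hZ01 : ∀ n i ω, Z n i ω ∈ Set.Icc (0:ℝ) 1)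
    (hI01 : ∀ n i ω, I n i ω = 0 ∨ I n i ω = 1)
    -- dynamics: `Z_{n+1}(i) = (1 - r_n) Z_n(i) + r_n (ρ I_{n+1}(i) + (1-ρ) q)`
    -- (here `I n i` stands for `I_{n+1}(i)`)
    (hdyn : ∀ n i ω, Z (n + 1) i ω
      = (1 - r n) * Z n i ω + r n * (ρ * I n i ω + (1 - ρ) * q))
    -- conditional independence of `I_{n+1}(1), …, I_{n+1}(N)` given `F_n`, together with
    -- the conditional law `P(I_{n+1}(i) = 1 | F_n) = (1-α) Z_n(i) + α Z_n`, expressed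
    -- (equivalently, for {0,1}-valued variables) through conditional product moments
    (hcond : ∀ n (s : Finset (Fin N)),
      μ[(fun ω => ∏ i ∈ s, I n i ω) | walkFiltration Z n]
        =ᵐ[μ] fun ω => ∏ i ∈ s, ((1 - α) * Z n i ω + α * walkMean Z n ω))
    -- the initial configuration is permutation invariant with mean 1/2 and E[Z_0(1-Z_0)] > 0
    (hperm : ∀ σ : Equiv.Perm (Fin N),
      μ.map (fun ω (i : Fin N) => Z 0 (σ i) ω) = μ.map (fun ω (i : Fin N) => Z 0 i ω))
    (hmean0 : ∀ i, ∫ ω, Z 0 i ω ∂μ = 1 / 2)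
    (hvar0 : 0 < ∫ ω, walkMean Z 0 ω * (1 - walkMean Z 0 ω) ∂μ)
    (hρ1 : ρ = 1) (hα0 : 0 < α)
    (c γ : ℝ) (hc : 0 < c) (hγ : 1/2 < γ ∧ γ ≤ 1)
    (hlim : Tendsto (fun n : ℕ => (n : ℝ) ^ γ * r n) atTop (nhds c)) :
    ∀ ε > 0, ∀ᵐ ω ∂μ, Tendsto
      (fun n : ℕ => (n : ℝ) ^ (-((1/2 + ε) * (2 * γ - 1))) *
        ∑ k ∈ Finset.range n, ((k : ℝ) + 1) ^ (2 * γ - 1) *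
          (walkMean Z (k + 1) ω - walkMean Z k ω))
      atTop (nhds 0) := by
  intro ε hε
  have hle : ∀ n, walkFiltration Z n ≤ ‹MeasurableSpace Ω› := by
    intro n
    unfold walkFiltration
    exact iSup₂_le fun k _ => iSup_le fun i => (hZmeas k i).comap_le
  have hmono : Monotone (walkFiltration Z) := by
    intro m n hmn
    unfold walkFiltration
    refine iSup₂_le fun k hk => le_iSup₂_of_le k ?_ le_rfl
    simp only [Finset.mem_range] at hk ⊢
    omega
  let F : Filtration ℕ ‹MeasurableSpace Ω› := ⟨walkFiltration Z, hmono, hle⟩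
  have hI' : ∀ n i ω, I n i ω ∈ Set.Icc (0:ℝ) 1 := by
    intro n i ω
    rcases hI01 n i ω with h | h <;> simp [h]
  have hinc : ∀ k ω, walkMean Z (k + 1) ω - walkMean Z k ω
      = r k * (walkMean I k ω - walkMean Z k ω) := by
    intro k ω
    unfold walkMean
    simp_rw [hdyn, hρ1]
    rw [Finset.sum_add_distrib, ← Finset.mul_sum, ← Finset.mul_sum]
    simp
    ring
  set w : ℕ → ℝ := fun k => ((k : ℝ) + 1) ^ ((1/2 - ε) * (2 * γ - 1)) with hw
  have hw0 : ∀ k, 0 ≤ w k := fun k => Real.rpow_nonneg (by positivity) _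
  have key := aux_conv_s19 μ F (fun k ω => w k * (walkMean Z (k + 1) ω - walkMean Z k ω))
    (fun k => w k * r k)
    (fun k => ((aux_mean_meas Z (k + 1) (k + 1) le_rfl).sub
      (aux_mean_meas Z k (k + 1) (Nat.le_succ k))).const_mul _)
    (fun k ω => by
      have h1 := aux_mean01 hN Z hZ01 k ω
      have h2 := aux_mean01 hN I hI' k ω
      have h3 : |walkMean I k ω - walkMean Z k ω| ≤ 1 :=
        abs_le.2 ⟨by linarith [h1.2, h2.1], by linarith [h1.1, h2.2]⟩
      rw [hinc, abs_mul, abs_mul, abs_of_nonneg (hw0 k), abs_of_nonneg (hr k).1]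
      exact mul_le_mul_of_nonneg_left (mul_le_of_le_one_right (hr k).1 h3) (hw0 k))
    (aux_summable r hr c γ hγ hlim ε hε)
    (fun k => by
      simp_rw [hinc, ← mul_assoc]
      exact aux_cond μ hN α Z I hle hImeas hZ01 hI' hcond k _)
  filter_upwards [key] with ω hω
  obtain ⟨L, hL⟩ := hω
  have hb : 0 < 2 * γ - 1 := by linarith [hγ.1]
  have hk := aux_kronecker ((1/2 + ε) * (2 * γ - 1)) (by positivity) _ L hL
  refine hk.congr fun n => ?_
  congr 1
  refine Finset.sum_congr rfl fun k _ => ?_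
  rw [Finset.sum_range_succ, add_sub_cancel_left, ← mul_assoc, hw]
  simp only
  rw [← Real.rpow_add (by positivity)]
  congr 2
  ring
end
end
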